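/- arXiv:1205.0601 — 13 statements merged into one kernel-verified Lean document; each statement's English description precedes it below -/
import Mathlib

section
/- Let u be an integrable weight function on [a,b] with u(x) > 0 for almost every x in [a,b], and let Q_1, …, Q_n : [a,b] → ℂ satisfy the u-weighted orthonormality relations ∫_a^b u(x) Q_i(x) conj(Q_l(x)) dx = δ_{il} for all 1 ≤ i, l ≤ n (all integrands being integrable). Fix n pairwise distinct points x_1, …, x_n in [a,b] and let q_j := (Q_1(x_j), …, Q_n(x_j)) ∈ ℂ^n. Then there exist nonzero complex weights w_1, …, w_n such that δ_{il} = Σ_{j=1}^n w_j Q_i(x_j) conj(Q_l(x_j)) for all 1 ≤ i, l ≤ n if and only if the vectors q_1, …, q_n are pairwise orthogonal in ℂ^n (with respect to the standard Hermitian inner product) and each q_j is nonzero. -/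
open MeasureTheory ComplexConjugate

/-- The duality between row and column orthogonality as a matrix identity. -/
lemma row_iff_col (n : ℕ) (A : Fin n → Fin n → ℂ) (w : Fin n → ℂ) :
    (∀ i l : Fin n, (if i = l then (1 : ℂ) else 0) = ∑ j, w j * A i j * conj (A l j)) ↔
    (∀ j j' : Fin n, w j * ∑ i, conj (A i j) * A i j' = if j = j' then (1 : ℂ) else 0) := by
  let M : Matrix (Fin n) (Fin n) ℂ := Matrix.of A
  let N : Matrix (Fin n) (Fin n) ℂ := Matrix.of fun j l => w j * conj (A l j)
  have h1 : (∀ i l : Fin n, (if i = l then (1 : ℂ) else 0) =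
      ∑ j, w j * A i j * conj (A l j)) ↔ M * N = 1 := by
    rw [← Matrix.ext_iff]
    refine forall_congr' fun i => forall_congr' fun l => ?_
    rw [Matrix.mul_apply, Matrix.one_apply, eq_comm]
    have : ∑ j, w j * A i j * conj (A l j) = ∑ j, M i j * N j l :=
      Finset.sum_congr rfl fun j _ => by simp only [M, N, Matrix.of_apply]; ring
    rw [this]
  have h2 : (∀ j j' : Fin n, w j * ∑ i, conj (A i j) * A i j' =
      if j = j' then (1 : ℂ) else 0) ↔ N * M = 1 := by
    rw [← Matrix.ext_iff]
    refine forall_congr' fun i => forall_congr' fun l => ?_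
    rw [Matrix.mul_apply, Matrix.one_apply, Finset.mul_sum]
    have : ∑ k, w i * (conj (A k i) * A k l) = ∑ j, N i j * M j l :=
      Finset.sum_congr rfl fun j _ => by simp only [M, N, Matrix.of_apply]; ring
    rw [this]
  rw [h1, h2, mul_eq_one_comm]

/-- Theorem 0.1 (duality of row and column orthogonalities): with a positive weight `u` and
`u`-orthonormal functions `Q_1, …, Q_n`, an `n`-term quadrature with distinct nodes `x_j` and
nonzero weights `w_j` integrating all inner products exists iff the vectors
`q_j = (Q_1(x_j), …, Q_n(x_j))` are pairwise orthogonal and nonzero. -/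
theorem stmt_0 (a b : ℝ) (hab : a < b) (n : ℕ) (hn : 1 ≤ n)
    (u : ℝ → ℝ) (hu : IntervalIntegrable u volume a b)
    (hupos : ∀ᵐ x ∂(volume.restrict (Set.Icc a b)), 0 < u x)
    (Q : Fin n → ℝ → ℂ)
    (hQint : ∀ i l : Fin n,
      IntervalIntegrable (fun x => (u x : ℂ) * Q i x * conj (Q l x)) volume a b)
    (horth : ∀ i l : Fin n,
      (∫ x in a..b, (u x : ℂ) * Q i x * conj (Q l x)) = if i = l then 1 else 0)
    (x : Fin n → ℝ) (hxmem : ∀ j, x j ∈ Set.Icc a b)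
    (hxdist : Function.Injective x) :
    (∃ w : Fin n → ℂ, (∀ j, w j ≠ 0) ∧
      ∀ i l : Fin n, (if i = l then (1 : ℂ) else 0) =
        ∑ j, w j * Q i (x j) * conj (Q l (x j)))
    ↔ ((∀ j j' : Fin n, j ≠ j' → ∑ i, conj (Q i (x j)) * Q i (x j') = 0) ∧
        (∀ j, (fun i => Q i (x j)) ≠ (0 : Fin n → ℂ))) := by
  have key := fun w => row_iff_col n (fun i j => Q i (x j)) w
  constructor
  · rintro ⟨w, hw, h⟩
    have h' := (key w).1 h
    refine ⟨fun j j' hj => ?_, fun j h0 => ?_⟩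
    · have := h' j j'
      rw [if_neg hj] at this
      exact (mul_eq_zero.1 this).resolve_left (hw j)
    · have := h' j j
      have h0' : ∀ i, Q i (x j) = 0 := fun i => congrFun h0 i
      simp [h0'] at this
  · rintro ⟨ho, hz⟩
    have hne : ∀ j, ∑ i, conj (Q i (x j)) * Q i (x j) ≠ 0 := by
      intro j h0
      apply hz j
      have h1 : ∑ i, Complex.normSq (Q i (x j)) = 0 := by
        have : ((∑ i, Complex.normSq (Q i (x j)) : ℝ) : ℂ) = 0 := by
          rw [← h0, Complex.ofReal_sum]
          exact Finset.sum_congr rfl fun i _ => Complex.normSq_eq_conj_mul_self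
        exact_mod_cast this
      rw [Finset.sum_eq_zero_iff_of_nonneg fun i _ => Complex.normSq_nonneg _] at h1
      funext i
      exact Complex.normSq_eq_zero.1 (h1 i (Finset.mem_univ i))
    refine ⟨fun j => (∑ i, conj (Q i (x j)) * Q i (x j))⁻¹,
      fun j => inv_ne_zero (hne j), (key _).2 fun j j' => ?_⟩
    by_cases hj : j = j'
    · subst hj
      rw [if_pos rfl]
      exact inv_mul_cancel₀ (hne j)
    · rw [if_neg hj]
      simp only [ho j j' hj, mul_zero]
end

section
/- Let u be an integrable weight function on [a,b] with u(x) > 0 for almost every x in [a,b], and let Q_1, …, Q_n : [a,b] → ℂ satisfy ∫_a^b u(x) Q_i(x) conj(Q_l(x)) dx = δ_{il} for all 1 ≤ i, l ≤ n. Suppose x_1, …, x_n are pairwise distinct points of [a,b] and w_1, …, w_n are nonzero complex numbers such that δ_{il} = Σ_{j=1}^n w_j Q_i(x_j) conj(Q_l(x_j)) for all 1 ≤ i, l ≤ n. Then each weight is uniquely determined, real and positive, and is given by w_j = 1 / (Σ_{i=1}^n |Q_i(x_j)|²), i.e. w_j = 1/‖Q(n,x_j)‖₂², where Q(n,x_j)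 := (Q_1(x_j), …, Q_n(x_j)) ∈ ℂ^n. -/
open MeasureTheory ComplexConjugate

/-- The weight formula (2.7a): if an `n`-term quadrature with distinct nodes and nonzero
weights integrates all inner products of `u`-orthonormal functions `Q_1, …, Q_n`, then each
weight is real and positive, and `w_j = 1/‖Q(n,x_j)‖₂²`. -/
theorem stmt_1 (a b : ℝ) (hab : a < b) (n : ℕ) (hn : 1 ≤ n)
    (u : ℝ → ℝ) (hu : IntervalIntegrable u volume a b)
    (hupos : ∀ᵐ x ∂(volume.restrict (Set.Icc a b)), 0 < u x)
    (Q : Fin n → ℝ → ℂ)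
    (hQint : ∀ i l : Fin n,
      IntervalIntegrable (fun x => (u x : ℂ) * Q i x * conj (Q l x)) volume a b)
    (horth : ∀ i l : Fin n,
      (∫ x in a..b, (u x : ℂ) * Q i x * conj (Q l x)) = if i = l then 1 else 0)
    (x : Fin n → ℝ) (hxmem : ∀ j, x j ∈ Set.Icc a b)
    (hxdist : Function.Injective x)
    (w : Fin n → ℂ) (hw : ∀ j, w j ≠ 0)
    (hquad : ∀ i l : Fin n, (if i = l then (1 : ℂ) else 0) =
      ∑ j, w j * Q i (x j) * conj (Q l (x j))) :
    ∀ j, 0 < ∑ i, Complex.normSq (Q i (x j)) ∧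
      w j = (((∑ i, Complex.normSq (Q i (x j))) : ℝ) : ℂ)⁻¹ := by
  intro j
  let A : Matrix (Fin n) (Fin n) ℂ := Matrix.of fun i j => w j * Q i (x j)
  let B : Matrix (Fin n) (Fin n) ℂ := Matrix.of fun j l => conj (Q l (x j))
  have hAB : A * B = 1 := by
    ext i l
    rw [Matrix.mul_apply, Matrix.one_apply]
    exact (hquad i l).symm
  have hBA : B * A = 1 := mul_eq_one_comm.mp hAB
  have hjj : w j * (((∑ i, Complex.normSq (Q i (x j))) : ℝ) : ℂ) = 1 := by
    have h := congrFun (congrFun hBA j) j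
    rw [Matrix.mul_apply, Matrix.one_apply_eq] at h
    rw [← h, Complex.ofReal_sum, Finset.mul_sum]
    refine Finset.sum_congr rfl fun i _ => ?_
    simp only [A, B, Matrix.of_apply, Complex.normSq_eq_conj_mul_self]
    ring
  refine ⟨?_, eq_inv_of_mul_eq_one_left hjj⟩
  refine lt_of_le_of_ne (Finset.sum_nonneg fun i _ => Complex.normSq_nonneg _) fun h0 => ?_
  rw [← h0] at hjj
  simp at hjj
end

section
/- Let u : [a,b] → ℂ be integrable (not necessarily positive), and let T_1, …, T_n be linearly independent complex polynomial functions of degree < n. Define the n×n Gramian matrices B_{il} = ∫_a^b u(x) T_i(x) conj(T_l(x)) dx and A_{il} = ∫_a^b u(x) · x · T_i(x) conj(T_l(x)) dx. Suppose there is an n-term quadrature {x_j, w_j} (pairwise distinct nodes x_j ∈ [a,b], nonzero complex weights w_j) integrating both A and B exactly, i.e. B_{il} = Σ_j w_j T_i(x_j) conj(T_l(x_j)) and A_{il} = Σ_j w_j x_j T_i(x_j) conj(T_l(x_j)) for all i, l, and suppose B is invertible. Then the n×n matrix T(n,{x_j}) whose j-th column is T(n,x_j) := (T_1(x_j), …,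 T_n(x_j)) is invertible, for every j one has (A B⁻¹) · T(n,x_j) = x_j · T(n,x_j), and the characteristic polynomial of A B⁻¹ equals ∏_{j=1}^n (X − x_j); in particular the nodes x_j are exactly the eigenvalues of A B⁻¹. -/
open MeasureTheory ComplexConjugate Matrix Polynomial

/-- Theorem 1 (polynomial case): if an `n`-term quadrature with distinct nodes `x_j` and
nonzero weights integrates both Gramians `A` (with multiplier `μ(x) = x`) and `B` of a
linearly independent family of polynomials of degree `< n`, and `B` is invertible, then the
node matrix `T(n,{x_j})` is invertible, each vector `T(n,x_j)` is an eigenvector of `A B⁻¹`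
with eigenvalue `x_j`, and the characteristic polynomial of `A B⁻¹` is `∏_j (X - x_j)`. -/
theorem stmt_2 (a b : ℝ) (hab : a < b) (n : ℕ) (hn : 1 ≤ n)
    (u : ℝ → ℂ) (hu : IntervalIntegrable u volume a b)
    (T : Fin n → ℝ → ℂ)
    (hTpoly : ∀ i, ∃ P : Polynomial ℂ, P.degree < (n : ℕ) ∧ ∀ t : ℝ, T i t = P.eval (t : ℂ))
    (hTindep : LinearIndependent ℂ T)
    (hint1 : ∀ i l, IntervalIntegrable (fun t => u t * T i t * conj (T l t)) volume a b)
    (hint2 : ∀ i l, IntervalIntegrable (fun t => u t * (t : ℂ) * T i t * conj (T l t)) volume a b)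
    (B A : Matrix (Fin n) (Fin n) ℂ)
    (hB : ∀ i l, B i l = ∫ t in a..b, u t * T i t * conj (T l t))
    (hA : ∀ i l, A i l = ∫ t in a..b, u t * (t : ℂ) * T i t * conj (T l t))
    (x : Fin n → ℝ) (hxmem : ∀ j, x j ∈ Set.Icc a b) (hxdist : Function.Injective x)
    (w : Fin n → ℂ) (hw : ∀ j, w j ≠ 0)
    (hqB : ∀ i l, B i l = ∑ j, w j * T i (x j) * conj (T l (x j)))
    (hqA : ∀ i l, A i l = ∑ j, w j * (x j : ℂ) * T i (x j) * conj (T l (x j)))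
    (hBinv : IsUnit B.det) :
    IsUnit (Matrix.of fun i j => T i (x j)).det ∧
    (∀ j, (A * B⁻¹).mulVec (fun i => T i (x j)) = (x j : ℂ) • (fun i => T i (x j))) ∧
    (A * B⁻¹).charpoly = ∏ j, (X - C ((x j : ℂ))) := by
  set M : Matrix (Fin n) (Fin n) ℂ := Matrix.of fun i j => T i (x j) with hM
  set D : Matrix (Fin n) (Fin n) ℂ := Matrix.diagonal fun j => (x j : ℂ) with hD
  set N : Matrix (Fin n) (Fin n) ℂ := Matrix.of fun j l => w j * conj (T l (x j)) with hN
  have hBM : B = M * N := by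
    ext i l
    rw [hqB, Matrix.mul_apply]
    refine Finset.sum_congr rfl fun j _ => ?_
    simp only [hM, hN, Matrix.of_apply]
    ring
  have hAM : A = M * D * N := by
    ext i l
    rw [hqA, Matrix.mul_apply]
    refine Finset.sum_congr rfl fun j _ => ?_
    simp only [hM, hN, hD, Matrix.of_apply, Matrix.mul_diagonal]
    ring
  have hdet : IsUnit (M.det * N.det) := by
    rw [← Matrix.det_mul, ← hBM]
    exact hBinv
  have hMu : IsUnit M.det := isUnit_of_mul_isUnit_left hdet
  have hNu : IsUnit N.det := isUnit_of_mul_isUnit_right hdet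
  have hAB : A * B⁻¹ = M * D * M⁻¹ := by
    rw [hAM, hBM, Matrix.mul_inv_rev, ← Matrix.mul_assoc, Matrix.mul_nonsing_inv_cancel_right _ _ hNu]
  have hABM : A * B⁻¹ * M = M * D := by
    rw [hAB, Matrix.nonsing_inv_mul_cancel_right _ _ hMu]
  refine ⟨hMu, fun j => ?_, ?_⟩
  · ext i
    have h := congrFun (congrFun hABM i) j
    rw [Matrix.mul_apply, hD, Matrix.mul_diagonal] at h
    simp only [hM, Matrix.of_apply] at h
    simp only [Matrix.mulVec, dotProduct, Pi.smul_apply, smul_eq_mul]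
    rw [h, mul_comm]
  · rw [hAB, Matrix.mul_assoc, Matrix.charpoly_mul_comm, Matrix.nonsing_inv_mul_cancel_right _ _ hMu, hD,
      Matrix.charpoly_diagonal]
end

section
/- Let u : [a,b] → ℝ be integrable with u(x) > 0 for almost every x ∈ [a,b], and let T_1, …, T_n be linearly independent complex polynomial functions of degree < n. Define B_{il} = ∫_a^b u(x) T_i(x) conj(T_l(x)) dx and A_{il} = ∫_a^b u(x) x T_i(x) conj(T_l(x)) dx. Then B is Hermitian positive definite (hence invertible), and the following are equivalent: (i) there exist n pairwise distinct nodes x_1, …, x_n ∈ [a,b] and nonzero complex weights w_1, …, w_n such that B_{il} = Σ_j w_j T_i(x_j) conj(T_l(x_j)) and A_{il} = Σ_j w_j x_j T_i(x_j) conj(T_l(x_j)) for all i, l; (ii) there exist n pairwise distinct points x_1, …, x_n ∈ [a,b] such that for every j the vector T(n,x_j) := (T_1(x_j), …, T_n(x_j)) is nonzero and (A B⁻¹) · T(n,x_j) = x_j · T(n,x_j). Moreover, when these hold, the weights w_j are necessarily real and positive. -/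
open MeasureTheory ComplexConjugate Matrix Polynomial
open scoped ComplexOrder

lemma aux_poly (n : ℕ) (T : Fin n → ℝ → ℂ)
    (hTpoly : ∀ i, ∃ P : Polynomial ℂ, P.degree < (n : ℕ) ∧ ∀ t : ℝ, T i t = P.eval (t : ℂ))
    (hTindep : LinearIndependent ℂ T) (c : Fin n → ℂ) (hc : c ≠ 0) :
    ∃ Q : Polynomial ℂ, Q ≠ 0 ∧ Q.degree < (n : ℕ) ∧
      ∀ t : ℝ, ∑ i, c i * T i t = Q.eval (t : ℂ) := by
  choose P hP hPe using hTpoly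
  have he : ∀ t : ℝ, ∑ i, c i * T i t = (∑ i, C (c i) * P i).eval (t : ℂ) := by
    intro t
    simp [eval_finsetSum, hPe]
  refine ⟨∑ i, C (c i) * P i, ?_, ?_, he⟩
  · intro h0
    apply hc
    funext i
    refine Fintype.linearIndependent_iff.mp hTindep c ?_ i
    funext t
    have := he t
    rw [h0] at this
    simpa using this
  · rw [← Polynomial.mem_degreeLT]
    refine Submodule.sum_mem _ fun i _ => ?_
    rw [← smul_eq_C_mul]
    exact Submodule.smul_mem _ _ (Polynomial.mem_degreeLT.mpr (hP i))

lemma aux_unit (n : ℕ) (T : Fin n → ℝ → ℂ)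
    (hTpoly : ∀ i, ∃ P : Polynomial ℂ, P.degree < (n : ℕ) ∧ ∀ t : ℝ, T i t = P.eval (t : ℂ))
    (hTindep : LinearIndependent ℂ T) (x : Fin n → ℝ) (hx : Function.Injective x) :
    IsUnit (Matrix.of fun i j => T i (x j)) := by
  rw [← Matrix.vecMul_injective_iff_isUnit]
  rw [← Matrix.coe_vecMulLinear, ← LinearMap.ker_eq_bot, LinearMap.ker_eq_bot']
  intro c h
  by_contra hc
  obtain ⟨Q, hQ0, hQd, hQ⟩ := aux_poly n T hTpoly hTindep c hc
  apply hQ0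
  refine Polynomial.eq_zero_of_degree_lt_of_eval_index_eq_zero Finset.univ
    (v := fun j : Fin n => (x j : ℂ)) ?_ (by simpa using hQd) ?_
  · intro i _ j _ h
    exact hx (by simpa using h)
  · intro j _
    rw [← hQ]
    have := congrFun h j
    simpa [Matrix.vecMul, dotProduct] using this

lemma aux_pos (a b : ℝ) (hab : a < b) (n : ℕ)
    (u : ℝ → ℝ) 
    (hupos : ∀ᵐ t ∂(volume.restrict (Set.Icc a b)), 0 < u t)
    (T : Fin n → ℝ → ℂ)
    (hTpoly : ∀ i, ∃ P : Polynomial ℂ, P.degree < (n : ℕ) ∧ ∀ t : ℝ, T i t = P.eval (t : ℂ))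
    (hTindep : LinearIndependent ℂ T)
    (hint1 : ∀ i l, IntervalIntegrable (fun t => (u t : ℂ) * T i t * conj (T l t)) volume a b)
    (B : Matrix (Fin n) (Fin n) ℂ)
    (hB : ∀ i l, B i l = ∫ t in a..b, (u t : ℂ) * T i t * conj (T l t)) : B.PosDef := by
  refine Matrix.PosDef.of_dotProduct_mulVec_pos ?_ ?_
  · ext i l
    rw [Matrix.conjTranspose_apply, hB, hB, intervalIntegral.integral_of_le hab.le,
      intervalIntegral.integral_of_le hab.le, RCLike.star_def, ← integral_conj]
    congr 1
    funext t
    simp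
    ring
  · intro c hc
    have hc' : star c ≠ 0 := by simpa using hc
    obtain ⟨Q, hQ0, hQd, hQ⟩ := aux_poly n T hTpoly hTindep (star c) hc'
    set f : ℝ → ℝ := fun t => u t * Complex.normSq (Q.eval (t : ℂ)) with hf
    have hpt : ∀ t : ℝ, ((f t : ℝ) : ℂ) =
        ∑ i, ∑ l, star (c i) * c l * ((u t : ℂ) * T i t * conj (T l t)) := by
      intro t
      simp only [hf]
      rw [Complex.ofReal_mul, ← Complex.mul_conj, ← hQ, map_sum, Finset.sum_mul_sum,
        Finset.mul_sum]
      refine Finset.sum_congr rfl fun i _ => ?_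
      rw [Finset.mul_sum]
      refine Finset.sum_congr rfl fun l _ => ?_
      simp
      ring
    have hI : ∀ i l, IntervalIntegrable
        (fun t => star (c i) * c l * ((u t : ℂ) * T i t * conj (T l t))) volume a b :=
      fun i l => (hint1 i l).const_mul _
    have hI2 : ∀ i, IntervalIntegrable
        (fun t => ∑ l, star (c i) * c l * ((u t : ℂ) * T i t * conj (T l t))) volume a b := by
      intro i
      have := IntervalIntegrable.sum Finset.univ (fun l _ => hI i l)
      refine this.congr (fun t _ => ?_)
      simp
    have hI3 : IntervalIntegrable (fun t => ((f t : ℝ) : ℂ)) volume a b := by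
      have := IntervalIntegrable.sum Finset.univ (fun i _ => hI2 i)
      refine this.congr (fun t _ => ?_)
      simp [hpt]
    have heq : star c ⬝ᵥ (B *ᵥ c) = ((∫ t in a..b, f t : ℝ) : ℂ) := by
      rw [← intervalIntegral.integral_ofReal]
      simp_rw [hpt]
      rw [intervalIntegral.integral_finsetSum (fun i _ => hI2 i)]
      simp only [dotProduct, Matrix.mulVec]
      refine Finset.sum_congr rfl fun i _ => ?_
      rw [intervalIntegral.integral_finsetSum (fun l _ => hI i l), Finset.mul_sum]
      refine Finset.sum_congr rfl fun l _ => ?_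
      rw [intervalIntegral.integral_const_mul, hB]
      simp
      ring
    rw [heq, Complex.zero_lt_real, intervalIntegral.integral_of_le hab.le]
    have hfi : Integrable f (volume.restrict (Set.Ioc a b)) := by
      have := ((intervalIntegrable_iff_integrableOn_Ioc_of_le hab.le).mp hI3).re
      simpa using this
    have hfin : {t : ℝ | Q.eval (t : ℂ) = 0}.Finite := by
      have h1 : {z : ℂ | Q.IsRoot z}.Finite := Polynomial.finite_setOfPred_isRoot hQ0
      exact h1.preimage (f := fun t : ℝ => (t : ℂ)) Complex.ofReal_injective.injOn
    have hq : ∀ᵐ t : ℝ ∂(volume.restrict (Set.Ioc a b)), Q.eval (t : ℂ) ≠ 0 := by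
      refine ae_restrict_of_ae ?_
      rw [ae_iff]
      simpa using hfin.measure_zero volume
    have hu' : ∀ᵐ t ∂(volume.restrict (Set.Ioc a b)), 0 < u t :=
      ae_restrict_of_ae_restrict_of_subset Set.Ioc_subset_Icc_self hupos
    have hfp : ∀ᵐ t ∂(volume.restrict (Set.Ioc a b)), 0 < f t := by
      filter_upwards [hq, hu'] with t h1 h2
      exact mul_pos h2 (Complex.normSq_pos.mpr h1)
    have hf0 : 0 ≤ᵐ[volume.restrict (Set.Ioc a b)] f := by
      filter_upwards [hfp] with t h using h.le
    refine lt_of_le_of_ne (integral_nonneg_of_ae hf0) fun h => ?_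
    have h0 := (integral_eq_zero_iff_of_nonneg_ae hf0 hfi).mp h.symm
    have hF : ∀ᵐ t ∂(volume.restrict (Set.Ioc a b)), False := by
      filter_upwards [h0, hfp] with t h1 h2
      simp at h1
      linarith
    rw [ae_iff] at hF
    simp at hF
    linarith

/-- Theorem 2 (polynomial case, positive weight): with a positive weight `u` and linearly
independent polynomials `T_1, …, T_n` of degree `< n`, the Gramian `B` is Hermitian positive
definite, and an `n`-term quadrature integrating both Gramians `A` and `B` exists iff the
quotient matrix `A B⁻¹` has `n` eigenvalues `x_j ∈ [a,b]` with eigenvectors `T(n,x_j)`;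
moreover any such quadrature weights are real and positive. -/
theorem stmt_3 (a b : ℝ) (hab : a < b) (n : ℕ) (hn : 1 ≤ n)
    (u : ℝ → ℝ) (hu : IntervalIntegrable u volume a b)
    (hupos : ∀ᵐ t ∂(volume.restrict (Set.Icc a b)), 0 < u t)
    (T : Fin n → ℝ → ℂ)
    (hTpoly : ∀ i, ∃ P : Polynomial ℂ, P.degree < (n : ℕ) ∧ ∀ t : ℝ, T i t = P.eval (t : ℂ))
    (hTindep : LinearIndependent ℂ T)
    (hint1 : ∀ i l, IntervalIntegrable (fun t => (u t : ℂ) * T i t * conj (T l t)) volume a b)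
    (hint2 : ∀ i l,
      IntervalIntegrable (fun t => (u t : ℂ) * (t : ℂ) * T i t * conj (T l t)) volume a b)
    (B A : Matrix (Fin n) (Fin n) ℂ)
    (hB : ∀ i l, B i l = ∫ t in a..b, (u t : ℂ) * T i t * conj (T l t))
    (hA : ∀ i l, A i l = ∫ t in a..b, (u t : ℂ) * (t : ℂ) * T i t * conj (T l t)) :
    B.PosDef ∧
    ((∃ x : Fin n → ℝ, ∃ w : Fin n → ℂ,
        (∀ j, x j ∈ Set.Icc a b) ∧ Function.Injective x ∧ (∀ j, w j ≠ 0) ∧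
        (∀ i l, B i l = ∑ j, w j * T i (x j) * conj (T l (x j))) ∧
        (∀ i l, A i l = ∑ j, w j * (x j : ℂ) * T i (x j) * conj (T l (x j))))
      ↔
      (∃ x : Fin n → ℝ,
        (∀ j, x j ∈ Set.Icc a b) ∧ Function.Injective x ∧
        (∀ j, (fun i => T i (x j)) ≠ (0 : Fin n → ℂ)) ∧
        (∀ j, (A * B⁻¹).mulVec (fun i => T i (x j)) = (x j : ℂ) • (fun i => T i (x j))))) ∧
    (∀ x : Fin n → ℝ, ∀ w : Fin n → ℂ,
      (∀ j, x j ∈ Set.Icc a b) → Function.Injective x → (∀ j, w j ≠ 0) →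
      (∀ i l, B i l = ∑ j, w j * T i (x j) * conj (T l (x j))) →
      (∀ i l, A i l = ∑ j, w j * (x j : ℂ) * T i (x j) * conj (T l (x j))) →
      ∀ j, ∃ wr : ℝ, 0 < wr ∧ w j = (wr : ℂ)) := by
  have hBpos : B.PosDef := aux_pos a b hab n u hupos T hTpoly hTindep hint1 B hB
  have hBu : IsUnit B := hBpos.isUnit
  have hBdet : IsUnit B.det := (Matrix.isUnit_iff_isUnit_det _).mp hBu
  have hAh : Aᴴ = A := by
    ext i l
    rw [Matrix.conjTranspose_apply, hA, hA, intervalIntegral.integral_of_le hab.le,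
      intervalIntegral.integral_of_le hab.le, RCLike.star_def, ← integral_conj]
    congr 1
    funext t
    simp
    ring
  -- matrix form of the quadrature
  have hform : ∀ (x : Fin n → ℝ) (d : Fin n → ℂ) (i l : Fin n),
      ((Matrix.of fun i j => T i (x j)) * Matrix.diagonal d *
        (Matrix.of fun i j => T i (x j))ᴴ) i l = ∑ j, d j * T i (x j) * conj (T l (x j)) := by
    intro x d i l
    rw [Matrix.mul_apply]
    refine Finset.sum_congr rfl fun j _ => ?_
    rw [Matrix.mul_diagonal, Matrix.conjTranspose_apply, Matrix.of_apply, Matrix.of_apply,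
      mul_comm (T i (x j))]
    rfl
  refine ⟨hBpos, ⟨?_, ?_⟩, ?_⟩
  · rintro ⟨x, w, hx, hinj, hw, hBq, hAq⟩
    have hV := aux_unit n T hTpoly hTindep x hinj
    set V : Matrix (Fin n) (Fin n) ℂ := Matrix.of fun i j => T i (x j) with hVdef
    have hVdet : IsUnit V.det := (Matrix.isUnit_iff_isUnit_det _).mp hV
    have hBm : B = V * Matrix.diagonal w * Vᴴ := by
      ext i l
      rw [hform, hBq]
    have hAm : A = V * Matrix.diagonal (fun j => (x j : ℂ)) * V⁻¹ * B := by
      rw [hBm]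
      have : V * Matrix.diagonal (fun j => (x j : ℂ)) * V⁻¹ * (V * Matrix.diagonal w * Vᴴ)
          = V * Matrix.diagonal (fun j => w j * (x j : ℂ)) * Vᴴ := by
        calc _ = V * Matrix.diagonal (fun j => (x j : ℂ)) * (V⁻¹ * V) * Matrix.diagonal w * Vᴴ := by
              simp only [Matrix.mul_assoc]
          _ = _ := by
              rw [Matrix.nonsing_inv_mul _ hVdet, Matrix.mul_one, Matrix.mul_assoc V,
                Matrix.diagonal_mul_diagonal]
              simp only [mul_comm]
      rw [this]
      ext i l
      rw [hform, hAq]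
    have hABV : A * B⁻¹ * V = V * Matrix.diagonal (fun j => (x j : ℂ)) := by
      rw [hAm, Matrix.mul_nonsing_inv_cancel_right _ _ hBdet,
        Matrix.nonsing_inv_mul_cancel_right _ _ hVdet]
    refine ⟨x, hx, hinj, ?_, ?_⟩
    · intro j h0
      have hinjV := Matrix.mulVec_injective_iff_isUnit.mpr hV
      have h1 : V *ᵥ (Pi.single j 1) = V *ᵥ 0 := by
        rw [Matrix.mulVec_single_one, Matrix.mulVec_zero]
        exact h0
      have := congrFun (hinjV h1) j
      simp at this
    · intro j
      funext i
      have := congrFun (congrFun hABV i) j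
      rw [Matrix.mul_diagonal, Matrix.mul_apply] at this
      simp only [Matrix.mulVec, dotProduct, Pi.smul_apply, smul_eq_mul]
      rw [mul_comm]
      exact this
  · rintro ⟨x, hx, hinj, -, heig⟩
    have hV := aux_unit n T hTpoly hTindep x hinj
    set V : Matrix (Fin n) (Fin n) ℂ := Matrix.of fun i j => T i (x j) with hVdef
    have hVdet : IsUnit V.det := (Matrix.isUnit_iff_isUnit_det _).mp hV
    have hVhdet : IsUnit Vᴴ.det := by
      rw [Matrix.det_conjTranspose]
      exact hVdet.star
    set X : Matrix (Fin n) (Fin n) ℂ := Matrix.diagonal (fun j => (x j : ℂ)) with hX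
    have hABV : A * B⁻¹ * V = V * X := by
      ext i j
      have := congrFun (heig j) i
      rw [hX, Matrix.mul_diagonal, Matrix.mul_apply]
      simp only [Matrix.mulVec, dotProduct, Pi.smul_apply, smul_eq_mul] at this
      rw [mul_comm (V i j)]
      exact this
    set M : Matrix (Fin n) (Fin n) ℂ := V⁻¹ * B * (V⁻¹)ᴴ with hM
    have hVhi : (V⁻¹)ᴴ * Vᴴ = 1 := by
      rw [← Matrix.conjTranspose_mul, Matrix.mul_nonsing_inv _ hVdet, Matrix.conjTranspose_one]
    have hBM : B = V * M * Vᴴ := by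
      calc B = (V * V⁻¹) * B * ((V⁻¹)ᴴ * Vᴴ) := by
            rw [hVhi, Matrix.mul_nonsing_inv _ hVdet, Matrix.one_mul, Matrix.mul_one]
        _ = _ := by simp only [hM, Matrix.mul_assoc]
    have hAM : A = V * (X * M) * Vᴴ := by
      calc A = A * B⁻¹ * B := (Matrix.nonsing_inv_mul_cancel_right _ _ hBdet).symm
        _ = A * B⁻¹ * V * M * Vᴴ := by
            nth_rewrite 2 [hBM]
            simp only [Matrix.mul_assoc]
        _ = _ := by rw [hABV]; simp only [Matrix.mul_assoc]
    have hMh : Mᴴ = M := by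
      simp only [hM, Matrix.conjTranspose_mul, Matrix.conjTranspose_conjTranspose,
        hBpos.isHermitian.eq, Matrix.mul_assoc]
    have hXh : Xᴴ = X := by
      rw [hX, Matrix.diagonal_conjTranspose]
      congr 1
      funext j
      simp
    have hcomm : X * M = M * X := by
      have h1 : V * (M * X) * Vᴴ = V * (X * M) * Vᴴ := by
        rw [← hAM, ← hAh, hAM]
        simp only [Matrix.conjTranspose_mul, Matrix.conjTranspose_conjTranspose, hMh, hXh,
          Matrix.mul_assoc]
      have hVhu : IsUnit Vᴴ := (Matrix.isUnit_iff_isUnit_det _).mpr hVhdet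
      exact (hV.mul_left_cancel (hVhu.mul_right_cancel h1)).symm
    have hMd : M = Matrix.diagonal (fun j => M j j) := by
      ext i j
      by_cases hij : i = j
      · subst hij; simp
      · rw [Matrix.diagonal_apply_ne _ hij]
        have := congrFun (congrFun hcomm i) j
        rw [hX, Matrix.diagonal_mul, Matrix.mul_diagonal] at this
        have h2 : ((x i : ℂ) - x j) * M i j = 0 := by linear_combination this
        rcases mul_eq_zero.mp h2 with h | h
        · exact absurd (hinj (by exact_mod_cast sub_eq_zero.mp h)) hij
        · exact h
    have hMu : IsUnit M := by
      rw [hM]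
      have h1 : IsUnit V⁻¹ := by
        rw [Matrix.isUnit_nonsing_inv_iff]
        exact hV
      exact (h1.mul hBu).mul h1.star
    refine ⟨x, fun j => M j j, hx, hinj, ?_, ?_, ?_⟩
    · intro j h0
      have := (Matrix.isUnit_iff_isUnit_det _).mp hMu
      rw [hMd, Matrix.det_diagonal] at this
      exact this.ne_zero (Finset.prod_eq_zero (Finset.mem_univ j) h0)
    · intro i l
      rw [← hform, ← hMd, ← hBM]
    · intro i l
      rw [← hform x (fun j => M j j * (x j : ℂ))]
      rw [← Matrix.diagonal_mul_diagonal, ← hMd, ← hX, ← hcomm, ← hAM]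
  · intro x w hx hinj hw hBq _ j
    have hV := aux_unit n T hTpoly hTindep x hinj
    set V : Matrix (Fin n) (Fin n) ℂ := Matrix.of fun i j => T i (x j) with hVdef
    have hVdet : IsUnit V.det := (Matrix.isUnit_iff_isUnit_det _).mp hV
    have hBm : B = V * Matrix.diagonal w * Vᴴ := by
      ext i l
      rw [hform, hBq]
    rw [hBm] at hBpos
    have hd : (Matrix.diagonal w).PosDef := by
      have := (Matrix.IsUnit.posDef_star_right_conjugate_iff (x := Matrix.diagonal w) hV).mp hBpos
      exact this
    have hwj : 0 < w j := (Matrix.posDef_diagonal_iff.mp hd) j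
    obtain ⟨h1, h2⟩ := Complex.pos_iff.mp hwj
    exact ⟨(w j).re, h1, Complex.ext (by simp) (by simp [← h2])⟩
end

section
/- Let u : [a,b] → ℂ and μ : [a,b] → ℂ, and let T_1, …, T_n : [a,b] → ℂ be such that all integrands below are integrable. Define the n×n Gramian matrices B_{il} = ∫_a^b u(x) T_i(x) conj(T_l(x)) dx and A_{il} = ∫_a^b u(x) μ(x) T_i(x) conj(T_l(x)) dx. Suppose there is an n-term quadrature {x_j, w_j} (pairwise distinct nodes x_j ∈ [a,b], nonzero complex weights w_j) integrating both A and B exactly, i.e. B_{il} = Σ_j w_j T_i(x_j) conj(T_l(x_j)) and A_{il} = Σ_j w_j μ(x_j) T_i(x_j) conj(T_l(x_j)) for all i, l, and suppose B is invertible. Then the n×n matrix T(n,{x_j}) whose j-th column is T(n,x_j) := (T_1(x_j), …, T_n(x_j)) is invertible, and for every j one has (A B⁻¹) · T(n,x_j) = μ(x_j) · T(n,x_j); in particular each μ(x_j) is an eigenvalue of A B⁻¹ with eigenvector T(n,x_j). -/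
open MeasureTheory ComplexConjugate Matrix

/-- Theorem 5 (arbitrary systems of functions, necessity): if an `n`-term quadrature with
distinct nodes `x_j` and nonzero weights integrates both Gramians `A` (with multiplier `μ`)
and `B`, and `B` is invertible, then the node matrix `T(n,{x_j})` is invertible and each
vector `T(n,x_j)` is an eigenvector of `A B⁻¹` with eigenvalue `μ(x_j)`. -/
theorem stmt_4 (a b : ℝ) (hab : a < b) (n : ℕ) (hn : 1 ≤ n)
    (u μ : ℝ → ℂ) (T : Fin n → ℝ → ℂ)
    (hint1 : ∀ i l, IntervalIntegrable (fun t => u t * T i t * conj (T l t)) volume a b)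
    (hint2 : ∀ i l, IntervalIntegrable (fun t => u t * μ t * T i t * conj (T l t)) volume a b)
    (B A : Matrix (Fin n) (Fin n) ℂ)
    (hB : ∀ i l, B i l = ∫ t in a..b, u t * T i t * conj (T l t))
    (hA : ∀ i l, A i l = ∫ t in a..b, u t * μ t * T i t * conj (T l t))
    (x : Fin n → ℝ) (hxmem : ∀ j, x j ∈ Set.Icc a b) (hxdist : Function.Injective x)
    (w : Fin n → ℂ) (hw : ∀ j, w j ≠ 0)
    (hqB : ∀ i l, B i l = ∑ j, w j * T i (x j) * conj (T l (x j)))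
    (hqA : ∀ i l, A i l = ∑ j, w j * μ (x j) * T i (x j) * conj (T l (x j)))
    (hBinv : IsUnit B.det) :
    IsUnit (Matrix.of fun i j => T i (x j)).det ∧
    (∀ j, (A * B⁻¹).mulVec (fun i => T i (x j)) = μ (x j) • (fun i => T i (x j))) := by
  set M : Matrix (Fin n) (Fin n) ℂ := Matrix.of fun i j => T i (x j) with hM
  set N : Matrix (Fin n) (Fin n) ℂ := Matrix.of fun j l => w j * conj (T l (x j)) with hN
  have hBM : B = M * N := by
    ext i l
    rw [hqB, Matrix.mul_apply]
    refine Finset.sum_congr rfl fun j _ => ?_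
    simp only [hM, hN, Matrix.of_apply]
    ring
  have hAM : A = M * Matrix.diagonal (fun j => μ (x j)) * N := by
    ext i l
    rw [hqA, Matrix.mul_apply]
    refine Finset.sum_congr rfl fun j _ => ?_
    simp only [hM, hN, Matrix.of_apply, Matrix.mul_diagonal]
    ring
  have hdet : IsUnit M.det := by
    rw [hBM, Matrix.det_mul] at hBinv
    exact isUnit_of_mul_isUnit_left hBinv
  refine ⟨hdet, fun j => ?_⟩
  have h1 : M * (N * B⁻¹) = 1 := by
    rw [← Matrix.mul_assoc, ← hBM, Matrix.mul_nonsing_inv _ hBinv]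
  have h2 : (N * B⁻¹) * M = 1 := mul_eq_one_comm.mp h1
  have h3 : (A * B⁻¹) * M = M * Matrix.diagonal (fun j => μ (x j)) := by
    calc (A * B⁻¹) * M = M * Matrix.diagonal (fun j => μ (x j)) * ((N * B⁻¹) * M) := by
          rw [hAM]; simp only [Matrix.mul_assoc]
      _ = _ := by rw [h2, Matrix.mul_one]
  funext i
  have h4 := congrFun (congrFun h3 i) j
  rw [Matrix.mul_diagonal, Matrix.mul_apply] at h4
  simp only [Matrix.mulVec, dotProduct, Pi.smul_apply, smul_eq_mul]
  simp only [hM, Matrix.of_apply] at h4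
  rw [h4, mul_comm]
end

section
/- Let u : [a,b] → ℝ be integrable with u(x) > 0 for almost every x, let μ : [a,b] → ℂ, and let T_1, …, T_n : [a,b] → ℂ be such that all integrands below are integrable and the Gramian B with entries B_{il} = ∫_a^b u(x) T_i(x) conj(T_l(x)) dx is invertible; set A_{il} = ∫_a^b u(x) μ(x) T_i(x) conj(T_l(x)) dx. Let x_1, …, x_n be pairwise distinct points of [a,b] such that the n×n matrix T(n,{x_j}) with j-th column T(n,x_j) := (T_1(x_j), …, T_n(x_j)) is invertible. Then the following are equivalent: (ii) (A B⁻¹) · T(n,x_j) = μ(x_j) · T(n,x_j) for every j; (iii) there exist complex coefficients c_{il} (1 ≤ i, l ≤ n) such that the residual functions r_i(x) := μ(x) T_i(x) − Σ_l c_{il} T_l(x) are u-orthogonal to all the T_m, i.e. ∫_a^b u(x) r_i(x) conj(T_m(x)) dx = 0 for all i, m, and vanish at all the nodes: r_i(x_j) = 0 for all i and j. -/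
open MeasureTheory ComplexConjugate Matrix

/-- Equivalence (ii) ⇔ (iii) of Theorem 6: with a positive weight `u`, invertible Gramian `B`
and invertible node matrix `T(n,{x_j})`, the eigen relations `(A B⁻¹) T(n,x_j) = μ(x_j) T(n,x_j)`
hold iff every component of `(I - P_n)(μ·T)` — written concretely as the residuals
`μ T_i - Σ_l c_{il} T_l` that are `u`-orthogonal to all `T_m` — vanishes at all nodes. -/
theorem stmt_5 (a b : ℝ) (hab : a < b) (n : ℕ) (hn : 1 ≤ n)
    (u : ℝ → ℝ) (hu : IntervalIntegrable u volume a b)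
    (hupos : ∀ᵐ t ∂(volume.restrict (Set.Icc a b)), 0 < u t)
    (μ : ℝ → ℂ) (T : Fin n → ℝ → ℂ)
    (hint1 : ∀ i l, IntervalIntegrable (fun t => (u t : ℂ) * T i t * conj (T l t)) volume a b)
    (hint2 : ∀ i l,
      IntervalIntegrable (fun t => (u t : ℂ) * μ t * T i t * conj (T l t)) volume a b)
    (B A : Matrix (Fin n) (Fin n) ℂ)
    (hB : ∀ i l, B i l = ∫ t in a..b, (u t : ℂ) * T i t * conj (T l t))
    (hA : ∀ i l, A i l = ∫ t in a..b, (u t : ℂ) * μ t * T i t * conj (T l t))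
    (hBinv : IsUnit B.det)
    (x : Fin n → ℝ) (hxmem : ∀ j, x j ∈ Set.Icc a b) (hxdist : Function.Injective x)
    (hTx : IsUnit (Matrix.of fun i j => T i (x j)).det) :
    (∀ j, (A * B⁻¹).mulVec (fun i => T i (x j)) = μ (x j) • (fun i => T i (x j)))
    ↔
    (∃ c : Matrix (Fin n) (Fin n) ℂ,
      (∀ i m, (∫ t in a..b,
        (u t : ℂ) * (μ t * T i t - ∑ l, c i l * T l t) * conj (T m t)) = 0) ∧
      (∀ i j, μ (x j) * T i (x j) - ∑ l, c i l * T l (x j) = 0)) := by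
  have key : ∀ (c : Matrix (Fin n) (Fin n) ℂ) (i m : Fin n), (∫ t in a..b,
      (u t : ℂ) * (μ t * T i t - ∑ l, c i l * T l t) * conj (T m t)) = A i m - (c * B) i m := by
    intro c i m
    have h1 : ∀ t, (u t : ℂ) * (μ t * T i t - ∑ l, c i l * T l t) * conj (T m t)
        = (u t : ℂ) * μ t * T i t * conj (T m t)
          - ∑ l, c i l * ((u t : ℂ) * T l t * conj (T m t)) := by
      intro t
      rw [mul_sub, sub_mul, Finset.mul_sum, Finset.sum_mul]
      congr 1
      · ring
      · exact Finset.sum_congr rfl fun l _ => by ring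
    have hI : ∀ l ∈ Finset.univ, IntervalIntegrable
        (fun t => c i l * ((u t : ℂ) * T l t * conj (T m t))) volume a b :=
      fun l _ => (hint1 l m).const_mul (c i l)
    have hS : IntervalIntegrable
        (fun t => ∑ l, c i l * ((u t : ℂ) * T l t * conj (T m t))) volume a b := by
      have := IntervalIntegrable.sum Finset.univ hI
      have e : (fun t => ∑ l, c i l * ((u t : ℂ) * T l t * conj (T m t)))
          = ∑ l, fun t => c i l * ((u t : ℂ) * T l t * conj (T m t)) := by
        ext t
        simp
      rw [e]
      exact this
    simp_rw [h1]
    rw [intervalIntegral.integral_sub (hint2 i m) hS, intervalIntegral.integral_finsetSum hI,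
      ← hA, Matrix.mul_apply]
    congr 1
    refine Finset.sum_congr rfl fun l _ => ?_
    rw [intervalIntegral.integral_const_mul, ← hB]
  have node : ∀ c : Matrix (Fin n) (Fin n) ℂ,
      (∀ j, c.mulVec (fun i => T i (x j)) = μ (x j) • (fun i => T i (x j))) ↔
      (∀ i j, μ (x j) * T i (x j) - ∑ l, c i l * T l (x j) = 0) := by
    intro c
    constructor
    · intro h i j
      have := congrFun (h j) i
      simp only [Matrix.mulVec, dotProduct, Pi.smul_apply, smul_eq_mul] at this
      rw [this, sub_self]
    · intro h j
      ext i
      simp only [Matrix.mulVec, dotProduct, Pi.smul_apply, smul_eq_mul]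
      exact (sub_eq_zero.mp (h i j)).symm
  constructor
  · intro h
    refine ⟨A * B⁻¹, fun i m => ?_, (node _).1 h⟩
    rw [key, Matrix.mul_assoc, Matrix.nonsing_inv_mul _ hBinv, Matrix.mul_one, sub_self]
  · rintro ⟨c, h1, h2⟩
    have hc : A = c * B := by
      ext i m
      exact sub_eq_zero.mp ((key c i m).symm.trans (h1 i m))
    rw [hc, Matrix.mul_assoc, Matrix.mul_nonsing_inv _ hBinv, Matrix.mul_one]
    exact (node c).2 h2
end

section
/- Let u, μ : [a,b] → ℂ, let T_1, …, T_m : [a,b] → ℂ and S_1, …, S_n : [a,b] → ℂ have all integrands below integrable, and define the m×n Gramian matrices B_{il} = ∫_a^b u(x) T_i(x) conj(S_l(x)) dx and A_{il} = ∫_a^b u(x) μ(x) T_i(x) conj(S_l(x)) dx. Suppose there is an r-term quadrature {x_j, w_j}_{j=1}^r (pairwise distinct nodes x_j ∈ [a,b], nonzero complex weights w_j) exact for both, i.e. B_{il} = Σ_{j=1}^r w_j T_i(x_j) conj(S_l(x_j)) and A_{il} = Σ_{j=1}^r w_j μ(x_j) T_i(x_j) conj(S_l(x_j)) for all i, l,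 and suppose rank B = r. Then: (a) the m×r matrix T_r with entries (T_r)_{ij} = T_i(x_j) has rank r and the r×n matrix S_r with entries (S_r)_{jl} = conj(S_l(x_j)) has rank r (so T_r^H T_r and S_r S_r^H are invertible); (b) defining B⁺ := S_r^H (S_r S_r^H)⁻¹ diag(w_1, …, w_r)⁻¹ (T_r^H T_r)⁻¹ T_r^H, one has A B⁺ = T_r · diag(μ(x_1), …, μ(x_r)) · (T_r^H T_r)⁻¹ T_r^H; consequently (A B⁺) · (T_r e_j) = μ(x_j) · (T_r e_j) for each j = 1, …, r, the m×m matrix A B⁺ has rank at most r, and 0 is an eigenvalue of A B⁺ of algebraic multiplicity at least m − r. -/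
open MeasureTheory ComplexConjugate Matrix Polynomial

/-- Theorem 3.3 (rectangular, rank-deficient Gramians): if an `r`-term quadrature with
distinct nodes and nonzero weights is exact for both `m×n` Gramians `A` and `B`, and
`rank B = r`, then the node matrices `T_r` and `S_r` have rank `r`, and with the reflexive
generalized inverse `B⁺` built from the factorization `B = T_r diag(w) S_r` one has
`A B⁺ = T_r diag(μ(x_j)) (T_rᴴ T_r)⁻¹ T_rᴴ`; each column of `T_r` is an eigenvector of `A B⁺`
with eigenvalue `μ(x_j)`, `A B⁺` has rank at most `r`, and `0` is an eigenvalue of algebraic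
multiplicity at least `m - r`. -/
theorem stmt_7 (a b : ℝ) (hab : a < b) (m n r : ℕ) (hm : 1 ≤ m) (hn : 1 ≤ n)
    (hr : 1 ≤ r) (hrm : r ≤ m) (hrn : r ≤ n)
    (u μ : ℝ → ℂ) (T : Fin m → ℝ → ℂ) (S : Fin n → ℝ → ℂ)
    (hint1 : ∀ i l, IntervalIntegrable (fun t => u t * T i t * conj (S l t)) volume a b)
    (hint2 : ∀ i l, IntervalIntegrable (fun t => u t * μ t * T i t * conj (S l t)) volume a b)
    (B A : Matrix (Fin m) (Fin n) ℂ)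
    (hB : ∀ i l, B i l = ∫ t in a..b, u t * T i t * conj (S l t))
    (hA : ∀ i l, A i l = ∫ t in a..b, u t * μ t * T i t * conj (S l t))
    (x : Fin r → ℝ) (hxmem : ∀ j, x j ∈ Set.Icc a b) (hxdist : Function.Injective x)
    (w : Fin r → ℂ) (hw : ∀ j, w j ≠ 0)
    (hqB : ∀ i l, B i l = ∑ j, w j * T i (x j) * conj (S l (x j)))
    (hqA : ∀ i l, A i l = ∑ j, w j * μ (x j) * T i (x j) * conj (S l (x j)))
    (hrank : B.rank = r) :
    ∀ Tr : Matrix (Fin m) (Fin r) ℂ, Tr = Matrix.of (fun i j => T i (x j)) →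
    ∀ Sr : Matrix (Fin r) (Fin n) ℂ, Sr = Matrix.of (fun j l => conj (S l (x j))) →
      Tr.rank = r ∧ Sr.rank = r ∧
      IsUnit (Trᴴ * Tr).det ∧ IsUnit (Sr * Srᴴ).det ∧
      ∀ Bplus : Matrix (Fin n) (Fin m) ℂ,
        Bplus = Srᴴ * (Sr * Srᴴ)⁻¹ * (Matrix.diagonal w)⁻¹ * (Trᴴ * Tr)⁻¹ * Trᴴ →
        A * Bplus = Tr * Matrix.diagonal (fun j => μ (x j)) * (Trᴴ * Tr)⁻¹ * Trᴴ ∧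
        (∀ j, (A * Bplus).mulVec (fun i => Tr i j) = μ (x j) • (fun i => Tr i j)) ∧
        (A * Bplus).rank ≤ r ∧
        X ^ (m - r) ∣ (A * Bplus).charpoly := by
  intro Tr hTr Sr hSr
  have hBf : B = Tr * Matrix.diagonal w * Sr := by
    ext i l
    rw [hqB, Matrix.mul_apply]
    refine Finset.sum_congr rfl fun j _ => ?_
    rw [Matrix.mul_diagonal, hTr, hSr]
    simp only [Matrix.of_apply]
    ring
  have hAf : A = Tr * Matrix.diagonal (fun j => μ (x j)) * Matrix.diagonal w * Sr := by
    ext i l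
    rw [hqA, Matrix.mul_apply]
    refine Finset.sum_congr rfl fun j _ => ?_
    rw [Matrix.mul_diagonal, Matrix.mul_diagonal, hTr, hSr]
    simp only [Matrix.of_apply]
    ring
  clear hTr hSr
  have hTrank : Tr.rank = r := by
    apply le_antisymm
    · simpa using Tr.rank_le_card_width
    · have h := Matrix.rank_mul_le_left Tr (Matrix.diagonal w * Sr)
      rwa [← Matrix.mul_assoc, ← hBf, hrank] at h
  have hSrank : Sr.rank = r := by
    apply le_antisymm
    · simpa using Sr.rank_le_card_height
    · have h := Matrix.rank_mul_le_right (Tr * Matrix.diagonal w) Sr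
      rwa [← hBf, hrank] at h
  have key : ∀ M : Matrix (Fin r) (Fin r) ℂ, M.rank = r → IsUnit M.det := by
    intro M hM
    rw [← Matrix.isUnit_iff_isUnit_det]
    rw [← Matrix.mulVec_surjective_iff_isUnit]
    have : LinearMap.range M.mulVecLin = ⊤ := by
      apply Submodule.eq_top_of_finrank_eq
      rw [← Matrix.rank, hM]; simp
    exact LinearMap.range_eq_top.mp this
  have hTu : IsUnit (Trᴴ * Tr).det := key _ (by open scoped ComplexOrder in rw [Matrix.rank_conjTranspose_mul_self, hTrank])
  have hSu : IsUnit (Sr * Srᴴ).det := key _ (by open scoped ComplexOrder in rw [Matrix.rank_self_mul_conjTranspose, hSrank])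
  have hwu : IsUnit (Matrix.diagonal w).det := by
    rw [Matrix.det_diagonal, isUnit_iff_ne_zero]
    exact Finset.prod_ne_zero_iff.mpr fun j _ => hw j
  refine ⟨hTrank, hSrank, hTu, hSu, ?_⟩
  intro Bp hBp
  have hAB : A * Bp = Tr * Matrix.diagonal (fun j => μ (x j)) * (Trᴴ * Tr)⁻¹ * Trᴴ := by
    calc A * Bp = Tr * Matrix.diagonal (fun j => μ (x j)) * (Matrix.diagonal w *
          ((Sr * Srᴴ) * (Sr * Srᴴ)⁻¹) * (Matrix.diagonal w)⁻¹) * (Trᴴ * Tr)⁻¹ * Trᴴ := by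
            rw [hAf, hBp]; simp only [Matrix.mul_assoc]
      _ = _ := by
        rw [Matrix.mul_nonsing_inv _ hSu, Matrix.mul_one, Matrix.mul_nonsing_inv _ hwu,
          Matrix.mul_one]
  refine ⟨hAB, ?_, ?_, ?_⟩
  · intro j
    have h : A * Bp * Tr = Tr * Matrix.diagonal (fun j => μ (x j)) := by
      rw [hAB, Matrix.mul_assoc, Matrix.mul_assoc, Matrix.nonsing_inv_mul _ hTu, Matrix.mul_one]
    ext i
    have h2 := congrFun (congrFun h i) j
    rw [Matrix.mul_diagonal, Matrix.mul_apply] at h2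
    simp only [Matrix.mulVec, dotProduct, Pi.smul_apply, smul_eq_mul]
    rw [h2, mul_comm]
  · rw [hAB, Matrix.mul_assoc, Matrix.mul_assoc]
    exact (Matrix.rank_mul_le_left _ _).trans hTrank.le
  · rw [hAB, Matrix.mul_assoc, Matrix.mul_assoc]
    have h := Matrix.charpoly_mul_comm_of_le Tr
      (Matrix.diagonal (fun j => μ (x j)) * ((Trᴴ * Tr)⁻¹ * Trᴴ)) (by simpa using hrm)
    rw [h]
    simp
end

section
/- Let α < β and a ≤ b be reals, let p : ℝ → ℂ be continuous on [α,β], let q : ℝ → ℂ, and let G : ℝ → ℝ → ℂ be such that for every x ∈ [a,b] and every k ∈ [α,β], the function k ↦ G(k,x) is differentiable at k with derivative ∂_k G(k,x) = p(k) · q(x) · G(k,x) (i.e. G admits the minimal function with separable dependence μ(x,k) = p(k) q(x)). Then G has the exponential form: for every x ∈ [a,b] and every k ∈ [α,β], G(k,x) = exp( q(x) · ∫_α^k p(t) dt ) · r(x), where r(x) := G(α,x). -/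
open MeasureTheory

/-- Theorem 3.4 (substantive direction): a family `G(k,x)` admitting a minimal function with
separable dependence, i.e. `∂ₖ G(k,x) = p(k) q(x) G(k,x)`, is of exponential type:
`G(k,x) = exp(q(x) ∫_α^k p) · r(x)` with `r(x) = G(α,x)`. -/
theorem stmt_9 (α β a b : ℝ) (hαβ : α < β) (hab : a ≤ b)
    (p : ℝ → ℂ) (hp : ContinuousOn p (Set.Icc α β))
    (q : ℝ → ℂ) (G : ℝ → ℝ → ℂ)
    (hG : ∀ x ∈ Set.Icc a b, ∀ k ∈ Set.Icc α β,
      HasDerivAt (fun k' => G k' x) (p k * q x * G k x) k) :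
    ∀ x ∈ Set.Icc a b, ∀ k ∈ Set.Icc α β,
      G k x = Complex.exp (q x * ∫ t in α..k, p t) * G α x := by
  intro x hx
  have hP : ∀ k ∈ Set.Icc α β,
      HasDerivWithinAt (fun u => ∫ t in α..u, p t) (p k) (Set.Icc α β) k := by
    intro k hk
    haveI : Fact (k ∈ Set.Icc α β) := ⟨hk⟩
    refine intervalIntegral.integral_hasDerivWithinAt_right (t := Set.Icc α β) ?_ ?_ (hp k hk)
    · apply ContinuousOn.intervalIntegrable
      rw [Set.uIcc_of_le hk.1]
      exact hp.mono (Set.Icc_subset_Icc_right hk.2)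
    · exact hp.stronglyMeasurableAtFilter_nhdsWithin measurableSet_Icc k
  have hF : ∀ k ∈ Set.Icc α β,
      HasDerivWithinAt (fun u => Complex.exp (-(q x * ∫ t in α..u, p t)) * G u x) 0
        (Set.Icc α β) k := by
    intro k hk
    have h := (((hP k hk).const_mul (q x)).neg.cexp).mul (hG x hx k hk).hasDerivWithinAt
    refine h.congr_deriv ?_
    simp only [Pi.neg_apply]
    ring
  have hc := constant_of_derivWithin_zero (fun k hk => (hF k hk).differentiableWithinAt)
    (fun k hk => (hF k (Set.Ico_subset_Icc_self hk)).derivWithin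
      (uniqueDiffOn_Icc hαβ k (Set.Ico_subset_Icc_self hk)))
  intro k hk
  have h := hc k hk
  simp only [intervalIntegral.integral_same, mul_zero, neg_zero, Complex.exp_zero, one_mul] at h
  rw [← h, ← mul_assoc, ← Complex.exp_add, add_neg_cancel, Complex.exp_zero, one_mul]
end

section
/- Let u, μ : [a,b] → ℂ, let T_1, …, T_m and S_1, …, S_n : [a,b] → ℂ have all integrands below integrable, and define the m×n Gramians B_{il} = ∫_a^b u(x) T_i(x) conj(S_l(x)) dx and A_{il} = ∫_a^b u(x) μ(x) T_i(x) conj(S_l(x)) dx. Suppose there is an r-term Type-3 quadrature: pairwise distinct nodes x_1, …, x_r ∈ [a,b] and an m×r complex weight matrix W such that B_{il} = Σ_{j=1}^r W_{ij} conj(S_l(x_j)) and A_{il} = Σ_{j=1}^r W_{ij} μ(x_j) conj(S_l(x_j)) for all i, l, and suppose rank B = r. Then W has rank r, the r×n matrix S_r with entries (S_r)_{jl} = conj(S_l(x_j)) has rank r, and, with B⁺ := S_r^H (S_r S_r^H)⁻¹ (W^H W)⁻¹ W^H, one has A B⁺ = W · diag(μ(x_1), …, μ(x_r)) · (W^H W)⁻¹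 W^H; consequently (A B⁺) · (W e_j) = μ(x_j) · (W e_j) for each j = 1, …, r (so each μ(x_j) is an eigenvalue of A B⁺ with the j-th column of W as eigenvector), the matrix A B⁺ has rank at most r, and 0 is an eigenvalue of A B⁺ of algebraic multiplicity at least m − r. -/
open MeasureTheory ComplexConjugate Matrix Polynomial

/-- Theorem 3.5 (Type-3 quadratures for integral equations): if an `r`-term Type-3 quadrature
with distinct nodes `x_j` and `m×r` weight matrix `W` is exact for the `m×n` Gramians `A` and
`B`, and `rank B = r`, then `W` and `S_r` have rank `r`, and with
`B⁺ = S_rᴴ (S_r S_rᴴ)⁻¹ (Wᴴ W)⁻¹ Wᴴ` one has `A B⁺ = W diag(μ(x_j)) (Wᴴ W)⁻¹ Wᴴ`; each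
column of `W` is an eigenvector of `A B⁺` with eigenvalue `μ(x_j)`, `A B⁺` has rank at most
`r`, and `0` is an eigenvalue of algebraic multiplicity at least `m - r`. -/
theorem stmt_11 (a b : ℝ) (hab : a < b) (m n r : ℕ) (hm : 1 ≤ m) (hn : 1 ≤ n)
    (hr : 1 ≤ r) (hrm : r ≤ m) (hrn : r ≤ n)
    (u μ : ℝ → ℂ) (T : Fin m → ℝ → ℂ) (S : Fin n → ℝ → ℂ)
    (hint1 : ∀ i l, IntervalIntegrable (fun t => u t * T i t * conj (S l t)) volume a b)
    (hint2 : ∀ i l, IntervalIntegrable (fun t => u t * μ t * T i t * conj (S l t)) volume a b)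
    (B A : Matrix (Fin m) (Fin n) ℂ)
    (hB : ∀ i l, B i l = ∫ t in a..b, u t * T i t * conj (S l t))
    (hA : ∀ i l, A i l = ∫ t in a..b, u t * μ t * T i t * conj (S l t))
    (x : Fin r → ℝ) (hxmem : ∀ j, x j ∈ Set.Icc a b) (hxdist : Function.Injective x)
    (W : Matrix (Fin m) (Fin r) ℂ)
    (hqB : ∀ i l, B i l = ∑ j, W i j * conj (S l (x j)))
    (hqA : ∀ i l, A i l = ∑ j, W i j * μ (x j) * conj (S l (x j)))
    (hrank : B.rank = r) :
    W.rank = r ∧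
    ∀ Sr : Matrix (Fin r) (Fin n) ℂ, Sr = Matrix.of (fun j l => conj (S l (x j))) →
      Sr.rank = r ∧
      ∀ Bplus : Matrix (Fin n) (Fin m) ℂ,
        Bplus = Srᴴ * (Sr * Srᴴ)⁻¹ * (Wᴴ * W)⁻¹ * Wᴴ →
        A * Bplus = W * Matrix.diagonal (fun j => μ (x j)) * (Wᴴ * W)⁻¹ * Wᴴ ∧
        (∀ j, (A * Bplus).mulVec (fun i => W i j) = μ (x j) • (fun i => W i j)) ∧
        (A * Bplus).rank ≤ r ∧
        X ^ (m - r) ∣ (A * Bplus).charpoly := by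
  have hd : ∀ M : Matrix (Fin r) (Fin r) ℂ, M.rank = r → IsUnit M.det := by
    intro M hM
    rw [← Matrix.isUnit_iff_isUnit_det, ← Matrix.mulVec_surjective_iff_isUnit]
    have h1 : LinearMap.range M.mulVecLin = ⊤ := by
      apply Submodule.eq_top_of_finrank_eq
      rw [← Matrix.rank, hM]
      simp
    exact LinearMap.range_eq_top.mp h1
  have hBf : B = W * Matrix.of (fun j l => conj (S l (x j))) := by
    ext i l
    simp [hqB, Matrix.mul_apply]
  have hAf : A = W * Matrix.diagonal (fun j => μ (x j)) *
      Matrix.of (fun j l => conj (S l (x j))) := by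
    ext i l
    rw [Matrix.mul_apply]
    simp [hqA, Matrix.mul_diagonal]
  have hW : W.rank = r := by
    apply le_antisymm
    · simpa using W.rank_le_width
    · conv_lhs => rw [← hrank, hBf]
      exact Matrix.rank_mul_le_left _ _
  refine ⟨hW, ?_⟩
  intro Sr hSr
  rw [← hSr] at hBf hAf
  have hS : Sr.rank = r := by
    apply le_antisymm
    · simpa using Sr.rank_le_height
    · conv_lhs => rw [← hrank, hBf]
      exact Matrix.rank_mul_le_right _ _
  refine ⟨hS, ?_⟩
  intro Bp hBp
  have hSS : IsUnit (Sr * Srᴴ).det := hd _ (by open scoped ComplexOrder in rw [Matrix.rank_self_mul_conjTranspose, hS])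
  have hWW : IsUnit (Wᴴ * W).det := hd _ (by open scoped ComplexOrder in rw [Matrix.rank_conjTranspose_mul_self, hW])
  have hAB : A * Bp = W * Matrix.diagonal (fun j => μ (x j)) * (Wᴴ * W)⁻¹ * Wᴴ := by
    rw [hAf, hBp]
    calc _ = W * Matrix.diagonal (fun j => μ (x j)) * ((Sr * Srᴴ) * (Sr * Srᴴ)⁻¹) *
          (Wᴴ * W)⁻¹ * Wᴴ := by simp only [Matrix.mul_assoc]
      _ = _ := by rw [Matrix.mul_nonsing_inv _ hSS, Matrix.mul_one]
  have hABW : A * Bp * W = W * Matrix.diagonal (fun j => μ (x j)) := by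
    rw [hAB]
    calc _ = W * Matrix.diagonal (fun j => μ (x j)) * ((Wᴴ * W)⁻¹ * (Wᴴ * W)) := by
          simp only [Matrix.mul_assoc]
      _ = _ := by rw [Matrix.nonsing_inv_mul _ hWW, Matrix.mul_one]
  refine ⟨hAB, ?_, ?_, ?_⟩
  · intro j
    ext i
    have h := congrFun (congrFun hABW i) j
    rw [Matrix.mul_diagonal, Matrix.mul_apply] at h
    simp only [Matrix.mulVec, dotProduct, Pi.smul_apply, smul_eq_mul]
    rw [h, mul_comm]
  · rw [hAB, Matrix.mul_assoc, Matrix.mul_assoc]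
    exact (Matrix.rank_mul_le_left _ _).trans hW.le
  · rw [hAB, Matrix.mul_assoc, Matrix.mul_assoc,
      Matrix.charpoly_mul_comm_of_le _ _ (by simpa using hrm)]
    simp
end

section
/- Let D ⊆ ℝ² be a measurable set, let u : ℝ² → ℂ be integrable on D, let N := n(n+1)/2, and let T_1, …, T_N : ℝ² → ℂ be a basis of the space of complex bivariate polynomial functions of total degree < n. Define the N×N Gramians B_{il} = ∫_D u T_i conj(T_l), (A_x)_{il} = ∫_D u(x,y) · x · T_i(x,y) conj(T_l(x,y)) d(x,y), and (A_y)_{il} = ∫_D u(x,y) · y · T_i(x,y) conj(T_l(x,y)) d(x,y). Suppose there is an N-term quadrature: pairwise distinct points z_j = (x_j,y_j) ∈ D and nonzero complex weights w_j (j = 1, …, N) with B_{il} = Σ_j w_j T_i(z_j) conj(T_l(z_j)), (A_x)_{il} = Σ_j w_j x_j T_i(z_j) conj(T_l(z_j)), and (A_y)_{il} = Σ_j w_j y_j T_i(z_j) conj(T_l(z_j)) for all i, l, and suppose B is invertible. Then the N×N matrix whose j-th column is v_j := (T_1(z_j), …, T_N(z_j)) is invertible, and for every j one has (A_x B⁻¹)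 v_j = x_j v_j and (A_y B⁻¹) v_j = y_j v_j; in particular the node coordinates x_j are eigenvalues of A_x B⁻¹ and the y_j are eigenvalues of A_y B⁻¹. -/
open MeasureTheory ComplexConjugate Matrix

/-- If `B = V W Vᴴ` is invertible and `A = V (W X) Vᴴ`, then each column of `V` is an eigenvector
of `A B⁻¹`. -/
theorem quad_aux {N : ℕ} (V A B : Matrix (Fin N) (Fin N) ℂ) (w x : Fin N → ℂ)
    (hB : B = V * diagonal w * Vᴴ) (hA : A = V * diagonal x * (diagonal w * Vᴴ))
    (hBinv : IsUnit B.det) (j : Fin N) :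
    (A * B⁻¹).mulVec (V.col j) = x j • V.col j := by
  have hV : IsUnit V.det := by
    rw [hB, det_mul, det_mul, mul_assoc] at hBinv
    exact isUnit_of_mul_isUnit_left hBinv
  have hA2 : A = V * diagonal x * V⁻¹ * B := by
    rw [hA, hB, Matrix.mul_assoc V (diagonal w), Matrix.mul_assoc _ V⁻¹,
      Matrix.nonsing_inv_mul_cancel_left _ _ hV]
  have h : A * B⁻¹ * V = V * diagonal x := by
    rw [hA2, Matrix.mul_nonsing_inv_cancel_right _ _ hBinv,
      Matrix.nonsing_inv_mul_cancel_right _ _ hV]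
  funext i
  have := congrFun (congrFun h i) j
  rw [mul_diagonal] at this
  simp only [Pi.smul_apply, smul_eq_mul, col_apply]
  rw [mul_comm, ← this]
  rfl

/-- Theorem 3 (two-dimensional case): if an `N`-term quadrature (`N = n(n+1)/2`) with
pairwise distinct nodes `z_j = (x_j, y_j) ∈ D` and nonzero weights integrates the three
Gramians `B`, `A_x`, `A_y` of a basis of the bivariate polynomials of total degree `< n`,
and `B` is invertible, then the node matrix is invertible and for every `j` the vector
`(T_1(z_j), …, T_N(z_j))` is a common eigenvector of `A_x B⁻¹` and `A_y B⁻¹` with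
eigenvalues `x_j` and `y_j` respectively. -/
theorem stmt_12 (n : ℕ) (hn : 1 ≤ n) (N : ℕ) (hN : N = n * (n + 1) / 2)
    (D : Set (ℝ × ℝ)) (hD : MeasurableSet D)
    (u : ℝ × ℝ → ℂ) (hu : IntegrableOn u D)
    (T : Fin N → ℝ × ℝ → ℂ)
    (hTpoly : ∀ i, ∃ P : MvPolynomial (Fin 2) ℂ, P.totalDegree < n ∧
      ∀ z : ℝ × ℝ, T i z = MvPolynomial.eval (fun j => ((![z.1, z.2] j : ℝ) : ℂ)) P)
    (hTindep : LinearIndependent ℂ T)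
    (hTspan : ∀ P : MvPolynomial (Fin 2) ℂ, P.totalDegree < n →
      (fun z : ℝ × ℝ => MvPolynomial.eval (fun j => ((![z.1, z.2] j : ℝ) : ℂ)) P) ∈
        Submodule.span ℂ (Set.range T))
    (hint : ∀ i l, IntegrableOn (fun z => u z * T i z * conj (T l z)) D)
    (hintx : ∀ i l, IntegrableOn (fun z => u z * (z.1 : ℂ) * T i z * conj (T l z)) D)
    (hinty : ∀ i l, IntegrableOn (fun z => u z * (z.2 : ℂ) * T i z * conj (T l z)) D)
    (B Ax Ay : Matrix (Fin N) (Fin N) ℂ)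
    (hB : ∀ i l, B i l = ∫ z in D, u z * T i z * conj (T l z))
    (hAx : ∀ i l, Ax i l = ∫ z in D, u z * (z.1 : ℂ) * T i z * conj (T l z))
    (hAy : ∀ i l, Ay i l = ∫ z in D, u z * (z.2 : ℂ) * T i z * conj (T l z))
    (z : Fin N → ℝ × ℝ) (hzmem : ∀ j, z j ∈ D) (hzdist : Function.Injective z)
    (w : Fin N → ℂ) (hw : ∀ j, w j ≠ 0)
    (hqB : ∀ i l, B i l = ∑ j, w j * T i (z j) * conj (T l (z j)))
    (hqAx : ∀ i l, Ax i l = ∑ j, w j * ((z j).1 : ℂ) * T i (z j) * conj (T l (z j)))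
    (hqAy : ∀ i l, Ay i l = ∑ j, w j * ((z j).2 : ℂ) * T i (z j) * conj (T l (z j)))
    (hBinv : IsUnit B.det) :
    IsUnit (Matrix.of fun i j => T i (z j)).det ∧
    (∀ j, (Ax * B⁻¹).mulVec (fun i => T i (z j)) = ((z j).1 : ℂ) • (fun i => T i (z j))) ∧
    (∀ j, (Ay * B⁻¹).mulVec (fun i => T i (z j)) = ((z j).2 : ℂ) • (fun i => T i (z j))) := by
  have hB' : B = (Matrix.of fun i j => T i (z j)) * diagonal w *
      (Matrix.of fun i j => T i (z j))ᴴ := by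
    ext i l
    rw [hqB, Matrix.mul_apply]
    refine Finset.sum_congr rfl fun j _ => ?_
    simp only [mul_diagonal, conjTranspose_apply, of_apply, starRingEnd_apply]
    ring
  refine ⟨?_, fun j => ?_, fun j => ?_⟩
  · rw [hB', det_mul, det_mul, mul_assoc] at hBinv
    exact isUnit_of_mul_isUnit_left hBinv
  · refine quad_aux (Matrix.of fun i j => T i (z j)) Ax B w (fun j => ((z j).1 : ℂ)) hB' ?_ hBinv j
    ext i l
    rw [hqAx, Matrix.mul_apply]
    refine Finset.sum_congr rfl fun j _ => ?_
    simp only [mul_diagonal, diagonal_mul, conjTranspose_apply, of_apply, starRingEnd_apply]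
    ring
  · refine quad_aux (Matrix.of fun i j => T i (z j)) Ay B w (fun j => ((z j).2 : ℂ)) hB' ?_ hBinv j
    ext i l
    rw [hqAy, Matrix.mul_apply]
    refine Finset.sum_congr rfl fun j _ => ?_
    simp only [mul_diagonal, diagonal_mul, conjTranspose_apply, of_apply, starRingEnd_apply]
    ring
end

section
/- Let D ⊆ ℝ² be a measurable set of positive finite Lebesgue measure, let u : ℝ² → ℝ be integrable on D with u > 0 almost everywhere on D, let N := n(n+1)/2, and let T_1, …, T_N : ℝ² → ℂ be a basis of the space of complex bivariate polynomial functions of total degree < n. Define the N×N Gramians B_{il} = ∫_D u T_i conj(T_l), (A_x)_{il} = ∫_D u(x,y) x T_i conj(T_l), and (A_y)_{il} = ∫_D u(x,y) y T_i conj(T_l). Then B is Hermitian positive definite, and the following are equivalent: (i) there exist N pairwise distinct points z_j = (x_j,y_j) ∈ D and nonzero complex weights w_j such that the N-term quadrature {z_j, w_j} integrates B, A_x and A_y exactly, i.e. B_{il} = Σ_j w_j T_i(z_j) conj(T_l(z_j)), (A_x)_{il} = Σ_j w_j x_j T_i(z_j) conj(T_l(z_j)), (A_y)_{il} = Σ_j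 w_j y_j T_i(z_j) conj(T_l(z_j)) for all i, l; (ii) there exist N pairwise distinct points z_j = (x_j,y_j) ∈ D such that for every j the vector v_j := (T_1(z_j), …, T_N(z_j)) is nonzero and is a common eigenvector: (A_x B⁻¹) v_j = x_j v_j and (A_y B⁻¹) v_j = y_j v_j. Moreover, when these hold the weights w_j are necessarily real and positive. -/
open MeasureTheory ComplexConjugate Matrix
open scoped ComplexOrder

lemma aux_finite (g : Fin 2 → Polynomial ℂ) (P : MvPolynomial (Fin 2) ℂ) (t₀ : ℝ)
    (h : MvPolynomial.eval (fun j => (g j).eval (t₀ : ℂ)) P ≠ 0) :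
    {t : ℝ | MvPolynomial.eval (fun j => (g j).eval (t : ℂ)) P = 0}.Finite := by
  have key : ∀ t : ℂ, (MvPolynomial.aeval g P).eval t
      = MvPolynomial.eval (fun j => (g j).eval t) P := by
    intro t
    clear h
    induction P using MvPolynomial.induction_on with
    | C a => simp
    | add p q hp hq => simp [hp, hq]
    | mul_X p i hp => simp [hp]
  have hne : MvPolynomial.aeval g P ≠ 0 := by
    intro h0
    apply h
    rw [← key, h0]; simp
  have := (Polynomial.finite_setOf_isRoot hne).preimage
    (f := fun t : ℝ => (t : ℂ)) (Complex.ofReal_injective.injOn)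
  refine this.subset ?_
  intro t ht
  simp only [Set.mem_preimage, Set.mem_setOf_eq, Polynomial.IsRoot.def] at ht ⊢
  rw [key, ht]

lemma aux_null (P : MvPolynomial (Fin 2) ℂ) (z₀ : ℝ × ℝ)
    (h : MvPolynomial.eval (fun j => ((![z₀.1, z₀.2] j : ℝ) : ℂ)) P ≠ 0) :
    ∀ᵐ z : ℝ × ℝ, MvPolynomial.eval (fun j => ((![z.1, z.2] j : ℝ) : ℂ)) P ≠ 0 := by
  have hcont : Continuous (fun z : ℝ × ℝ =>
      MvPolynomial.eval (fun j => ((![z.1, z.2] j : ℝ) : ℂ)) P) := by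
    apply (MvPolynomial.continuous_eval P).comp
    apply continuous_pi
    intro j
    fin_cases j
    · simp; fun_prop
    · simp; fun_prop
  have hm : MeasurableSet {z : ℝ × ℝ |
      MvPolynomial.eval (fun j => ((![z.1, z.2] j : ℝ) : ℂ)) P = 0} :=
    (isClosed_eq hcont continuous_const).measurableSet
  rw [ae_iff]
  simp only [ne_eq, not_not]
  rw [Measure.volume_eq_prod, Measure.measure_prod_null hm]
  have e1 : ∀ x : ℝ, (fun j => (![Polynomial.X, Polynomial.C (z₀.2 : ℂ)] j).eval (x : ℂ))
      = fun j => ((![x, z₀.2] j : ℝ) : ℂ) := by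
    intro x; funext j; fin_cases j <;> simp
  have e2 : ∀ x y : ℝ, (fun j => (![Polynomial.C (x : ℂ), Polynomial.X] j).eval (y : ℂ))
      = fun j => ((![x, y] j : ℝ) : ℂ) := by
    intro x y; funext j; fin_cases j <;> simp
  have hf := aux_finite ![Polynomial.X, Polynomial.C (z₀.2 : ℂ)] P z₀.1 (by rw [e1]; exact h)
  have hx := hf.measure_zero volume
  have hx' : ∀ᵐ x : ℝ, MvPolynomial.eval (fun j => ((![x, z₀.2] j : ℝ) : ℂ)) P ≠ 0 := by
    rw [ae_iff]
    simp only [e1] at hx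
    simpa using hx
  filter_upwards [hx'] with x hx
  have hf2 := aux_finite ![Polynomial.C (x : ℂ), Polynomial.X] P z₀.2 (by rw [e2]; exact hx)
  have := hf2.measure_zero volume
  simp only [e2] at this
  simpa using this

lemma aux_posDef (n N : ℕ)
    (D : Set (ℝ × ℝ)) (hDpos : 0 < volume D)
    (u : ℝ × ℝ → ℝ)
    (hupos : ∀ᵐ z ∂(volume.restrict D), 0 < u z)
    (T : Fin N → ℝ × ℝ → ℂ)
    (hTpoly : ∀ i, ∃ P : MvPolynomial (Fin 2) ℂ, P.totalDegree < n ∧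
      ∀ z : ℝ × ℝ, T i z = MvPolynomial.eval (fun j => ((![z.1, z.2] j : ℝ) : ℂ)) P)
    (hTindep : LinearIndependent ℂ T)
    (hint : ∀ i l, IntegrableOn (fun z => (u z : ℂ) * T i z * conj (T l z)) D)
    (B : Matrix (Fin N) (Fin N) ℂ)
    (hB : ∀ i l, B i l = ∫ z in D, (u z : ℂ) * T i z * conj (T l z)) : B.PosDef := by
  refine Matrix.PosDef.of_dotProduct_mulVec_pos ?_ ?_
  · ext i l
    rw [Matrix.conjTranspose_apply, hB, hB, Complex.star_def, ← integral_conj]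
    congr 1; ext z
    simp; ring
  intro x hx
  choose P hPd hP using hTpoly
  let Q : MvPolynomial (Fin 2) ℂ := ∑ i, MvPolynomial.C (conj (x i)) * P i
  let p : ℝ × ℝ → ℂ := fun z => ∑ i, conj (x i) * T i z
  have hpQ : ∀ z : ℝ × ℝ, p z = MvPolynomial.eval (fun j => ((![z.1, z.2] j : ℝ) : ℂ)) Q := by
    intro z
    simp only [p, Q, map_sum, map_mul, MvPolynomial.eval_C, hP]
  have hne : ∃ z, p z ≠ 0 := by
    by_contra! hcon
    apply hx
    have := Fintype.linearIndependent_iff.mp hTindep (fun i => conj (x i)) (by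
      funext z
      have := hcon z
      simpa [p, Finset.sum_apply] using this)
    funext i
    simpa using this i
  obtain ⟨z₀, hz₀⟩ := hne
  have hnull := aux_null Q z₀ (by rw [← hpQ]; exact hz₀)
  have hexp : ∀ z, ((u z * Complex.normSq (p z) : ℝ) : ℂ)
      = ∑ i, ∑ l, conj (x i) * ((u z : ℂ) * T i z * conj (T l z)) * x l := by
    intro z
    push_cast
    rw [← Complex.mul_conj]
    simp only [p, map_sum, map_mul, Complex.conj_conj]
    rw [Finset.sum_mul_sum, Finset.mul_sum]
    simp only [Finset.mul_sum]
    refine Finset.sum_congr rfl fun i _ => Finset.sum_congr rfl fun l _ => ?_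
    ring
  have hi : ∀ i l, IntegrableOn (fun z => conj (x i) * ((u z : ℂ) * T i z * conj (T l z)) * x l) D :=
    fun i l => ((hint i l).const_mul _).mul_const _
  have hint1 : IntegrableOn (fun z => ((u z * Complex.normSq (p z) : ℝ) : ℂ)) D := by
    simp only [hexp]
    exact integrable_finsetSum _ fun i _ => integrable_finsetSum _ fun l _ => hi i l
  have hint2 : IntegrableOn (fun z => (u z * Complex.normSq (p z) : ℝ)) D := by
    have := hint1.re
    rw [IntegrableOn]
    simpa using this
  have heq : star x ⬝ᵥ B *ᵥ x = ((∫ z in D, (u z * Complex.normSq (p z) : ℝ) : ℝ) : ℂ) := by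
    rw [← integral_complex_ofReal]
    simp only [hexp]
    rw [integral_finset_sum _ (fun i _ => integrable_finsetSum _ fun l _ => hi i l)]
    simp only [dotProduct, mulVec, Finset.mul_sum]
    refine Finset.sum_congr rfl fun i _ => ?_
    rw [integral_finset_sum _ (fun l _ => hi i l)]
    refine Finset.sum_congr rfl fun l _ => ?_
    rw [integral_mul_const, integral_const_mul, ← hB]
    simp; ring
  rw [heq]
  rw [Complex.zero_lt_real]
  have hae : ∀ᵐ z ∂(volume.restrict D), 0 < u z * Complex.normSq (p z) := by
    filter_upwards [hupos, ae_restrict_of_ae hnull] with z h1 h2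
    rw [← hpQ] at h2
    exact mul_pos h1 (Complex.normSq_pos.mpr h2)
  rw [integral_pos_iff_support_of_nonneg_ae (hae.mono fun z hz => hz.le) hint2]
  have : volume.restrict D (Function.support (fun z => u z * Complex.normSq (p z)))ᶜ = 0 := by
    rw [← mem_ae_iff]
    filter_upwards [hae] with z hz
    exact hz.ne'
  have h2 : volume.restrict D Set.univ ≤ _ :=
    measure_mono (Set.union_compl_self (Function.support (fun z => u z * Complex.normSq (p z)))).ge
  have h3 := h2.trans (measure_union_le _ _)
  rw [this, add_zero, Measure.restrict_apply_univ] at h3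
  exact hDpos.trans_le h3

lemma aux_herm {N : ℕ} (D : Set (ℝ × ℝ)) (u g : ℝ × ℝ → ℝ)
    (T : Fin N → ℝ × ℝ → ℂ) (A : Matrix (Fin N) (Fin N) ℂ)
    (hA : ∀ i l, A i l = ∫ z in D, (u z : ℂ) * (g z : ℂ) * T i z * conj (T l z)) :
    A.IsHermitian := by
  ext i l
  rw [Matrix.conjTranspose_apply, hA, hA, Complex.star_def, ← integral_conj]
  congr 1; ext z
  simp; ring

lemma aux_expand {N : ℕ} (V : Matrix (Fin N) (Fin N) ℂ) (d : Fin N → ℂ) (i l : Fin N) :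
    (V * diagonal d * Vᴴ) i l = ∑ j, d j * V i j * conj (V l j) := by
  rw [Matrix.mul_apply]
  refine Finset.sum_congr rfl fun j _ => ?_
  rw [Matrix.mul_diagonal, Matrix.conjTranspose_apply, Complex.star_def]; ring

lemma aux_isUnit {N : ℕ} (V B : Matrix (Fin N) (Fin N) ℂ) (w : Fin N → ℂ) (hB : B.PosDef)
    (h : B = V * diagonal w * Vᴴ) : IsUnit V := by
  rw [Matrix.isUnit_iff_isUnit_det]
  have := (Matrix.isUnit_iff_isUnit_det _).mp hB.isUnit
  rw [h, Matrix.det_mul, Matrix.det_mul] at this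
  exact isUnit_of_mul_isUnit_left (isUnit_of_mul_isUnit_left this)

lemma aux_weights {N : ℕ} (V B : Matrix (Fin N) (Fin N) ℂ) (w : Fin N → ℂ) (hB : B.PosDef)
    (h : B = V * diagonal w * Vᴴ) (j : Fin N) : 0 < w j := by
  have hV := aux_isUnit V B w hB h
  rw [h] at hB
  have := (Matrix.IsUnit.posDef_star_right_conjugate_iff hV).mp hB
  exact (Matrix.posDef_diagonal_iff.mp this) j

lemma aux_fwd {N : ℕ} (V B A : Matrix (Fin N) (Fin N) ℂ) (w d : Fin N → ℂ) (hB : B.PosDef)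
    (h : B = V * diagonal w * Vᴴ) (hA : A = V * diagonal (fun j => w j * d j) * Vᴴ)
    (j : Fin N) : (A * B⁻¹) *ᵥ (fun i => V i j) = d j • (fun i => V i j) := by
  have hV := aux_isUnit V B w hB h
  have hVd := (Matrix.isUnit_iff_isUnit_det _).mp hV
  have hBd := (Matrix.isUnit_iff_isUnit_det _).mp hB.isUnit
  have e : A = V * diagonal d * V⁻¹ * B := by
    rw [hA, h]
    have : V * diagonal d * V⁻¹ * (V * diagonal w * Vᴴ)
        = V * diagonal d * (V⁻¹ * V) * diagonal w * Vᴴ := by simp only [Matrix.mul_assoc]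
    rw [this, Matrix.nonsing_inv_mul _ hVd, Matrix.mul_one, Matrix.mul_assoc V (diagonal d), diagonal_mul_diagonal]
    simp only [mul_comm]
  have e2 : A * B⁻¹ * V = V * diagonal d := by
    rw [e, Matrix.mul_assoc _ B, Matrix.mul_nonsing_inv _ hBd, Matrix.mul_one, Matrix.mul_assoc _ V⁻¹,
      Matrix.nonsing_inv_mul _ hVd, Matrix.mul_one]
  funext i
  have := congrFun (congrFun e2 i) j
  rw [Matrix.mul_diagonal, Matrix.mul_apply] at this
  simp only [mulVec, dotProduct, Pi.smul_apply, smul_eq_mul]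
  rw [this, mul_comm]

lemma aux_col {N : ℕ} (V M : Matrix (Fin N) (Fin N) ℂ) (d : Fin N → ℂ)
    (h : ∀ j, M *ᵥ (fun i => V i j) = d j • (fun i => V i j)) : M * V = V * diagonal d := by
  ext i j
  rw [Matrix.mul_diagonal, Matrix.mul_apply]
  have := congrFun (h j) i
  simp only [mulVec, dotProduct, Pi.smul_apply, smul_eq_mul] at this
  rw [this, mul_comm]

/-- The matrix `Vᴴ B⁻¹ V` commutes with real eigenvalue diagonals. -/
lemma aux_comm {N : ℕ} (V B A : Matrix (Fin N) (Fin N) ℂ) (d : Fin N → ℝ) (hB : B.PosDef)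
    (hA : A.IsHermitian) (h : A * B⁻¹ * V = V * diagonal (fun j => (d j : ℂ))) (j k : Fin N) :
    (d j : ℂ) * (Vᴴ * B⁻¹ * V) j k = (Vᴴ * B⁻¹ * V) j k * d k := by
  have h1 : Vᴴ * B⁻¹ * (A * B⁻¹ * V) = Vᴴ * B⁻¹ * V * diagonal (fun j => (d j : ℂ)) := by
    rw [h, Matrix.mul_assoc _ V]
  have h2 : (A * B⁻¹ * V)ᴴ = diagonal (fun j => (d j : ℂ)) * Vᴴ := by
    rw [h, Matrix.conjTranspose_mul, diagonal_conjTranspose]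
    congr 2; ext j; simp
  have h3 : (A * B⁻¹ * V)ᴴ = Vᴴ * B⁻¹ * A := by
    rw [Matrix.conjTranspose_mul, Matrix.conjTranspose_mul, hA.eq, hB.inv.isHermitian.eq,
      Matrix.mul_assoc]
  have h4 : diagonal (fun j => (d j : ℂ)) * (Vᴴ * B⁻¹ * V)
      = Vᴴ * B⁻¹ * V * diagonal (fun j => (d j : ℂ)) := by
    rw [← h1, ← Matrix.mul_assoc, ← Matrix.mul_assoc, ← h2, h3]
    simp only [Matrix.mul_assoc]
  have := congrFun (congrFun h4 j) k
  rwa [Matrix.diagonal_mul, Matrix.mul_diagonal] at this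

lemma aux_bwd {N : ℕ} (V B Ax Ay : Matrix (Fin N) (Fin N) ℂ) (x y : Fin N → ℝ) (hB : B.PosDef)
    (hAx : Ax.IsHermitian) (hAy : Ay.IsHermitian)
    (hxy : ∀ j k, x j = x k → y j = y k → j = k)
    (hV : ∀ j, (fun i => V i j) ≠ 0)
    (hx : Ax * B⁻¹ * V = V * diagonal (fun j => (x j : ℂ)))
    (hy : Ay * B⁻¹ * V = V * diagonal (fun j => (y j : ℂ))) :
    ∃ w : Fin N → ℂ, (∀ j, w j ≠ 0) ∧ B = V * diagonal w * Vᴴ ∧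
      Ax = V * diagonal (fun j => w j * x j) * Vᴴ ∧
      Ay = V * diagonal (fun j => w j * y j) * Vᴴ := by
  have hBd := (Matrix.isUnit_iff_isUnit_det _).mp hB.isUnit
  let g : Fin N → ℂ := fun j => (Vᴴ * B⁻¹ * V) j j
  have hg : Vᴴ * B⁻¹ * V = diagonal g := by
    ext j k
    by_cases hjk : j = k
    · subst hjk; simp [g]
    rw [diagonal_apply_ne _ hjk]
    by_contra hne
    apply hjk
    have c1 := aux_comm V B Ax x hB hAx hx j k
    have c2 := aux_comm V B Ay y hB hAy hy j k
    rw [mul_comm] at c1 c2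
    exact hxy j k (by exact_mod_cast mul_left_cancel₀ hne c1)
      (by exact_mod_cast mul_left_cancel₀ hne c2)
  have hgpos : ∀ j, 0 < g j := by
    intro j
    have := hB.inv.dotProduct_mulVec_pos (hV j)
    convert this using 1
    simp only [g]
    rw [Matrix.mul_assoc, Matrix.mul_apply]
    rfl
  have hgd : diagonal g * diagonal (fun j => (g j)⁻¹) = 1 := by
    rw [diagonal_mul_diagonal, ← diagonal_one]
    congr 1; ext j; exact mul_inv_cancel₀ (hgpos j).ne'
  have hVr : (Vᴴ * B⁻¹) * (V * diagonal (fun j => (g j)⁻¹)) = 1 := by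
    rw [← Matrix.mul_assoc, hg, hgd]
  have hVl := mul_eq_one_comm.mp hVr
  have hBe : B = V * diagonal (fun j => (g j)⁻¹) * Vᴴ := by
    have : V * diagonal (fun j => (g j)⁻¹) * (Vᴴ * B⁻¹) * B = B := by rw [hVl, Matrix.one_mul]
    rw [← this]
    simp only [Matrix.mul_assoc]
    rw [Matrix.nonsing_inv_mul _ hBd, Matrix.mul_one]
  have fin : ∀ (A : Matrix (Fin N) (Fin N) ℂ) (d : Fin N → ℝ),
      A * B⁻¹ * V = V * diagonal (fun j => (d j : ℂ)) →
      A = V * diagonal (fun j => (g j)⁻¹ * d j) * Vᴴ := by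
    intro A d h
    have : A = A * B⁻¹ * B := by rw [Matrix.mul_assoc, Matrix.nonsing_inv_mul _ hBd, Matrix.mul_one]
    rw [this]
    nth_rewrite 2 [hBe]
    rw [← Matrix.mul_assoc, ← Matrix.mul_assoc, h, Matrix.mul_assoc V, diagonal_mul_diagonal]
    simp only [mul_comm]
  exact ⟨fun j => (g j)⁻¹, fun j => inv_ne_zero (hgpos j).ne', hBe, fin _ _ hx, fin _ _ hy⟩

/-- Theorem 4 (two-dimensional case, positive weight): with a positive weight `u` on a set
`D` of positive finite measure and a basis `T_1, …, T_N` (`N = n(n+1)/2`) of the bivariate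
polynomials of total degree `< n`, the Gramian `B` is Hermitian positive definite, and an
`N`-term quadrature integrating `B`, `A_x`, `A_y` exists iff the quotient matrices
`A_x B⁻¹` and `A_y B⁻¹` have common eigenvectors `(T_1(z_j), …, T_N(z_j))` with eigenvalues
`x_j` and `y_j`; moreover any such quadrature weights are real and positive. -/
theorem stmt_13 (n : ℕ) (hn : 1 ≤ n) (N : ℕ) (hN : N = n * (n + 1) / 2)
    (D : Set (ℝ × ℝ)) (hD : MeasurableSet D)
    (hDpos : 0 < volume D) (hDfin : volume D < ⊤)
    (u : ℝ × ℝ → ℝ) (hu : IntegrableOn u D)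
    (hupos : ∀ᵐ z ∂(volume.restrict D), 0 < u z)
    (T : Fin N → ℝ × ℝ → ℂ)
    (hTpoly : ∀ i, ∃ P : MvPolynomial (Fin 2) ℂ, P.totalDegree < n ∧
      ∀ z : ℝ × ℝ, T i z = MvPolynomial.eval (fun j => ((![z.1, z.2] j : ℝ) : ℂ)) P)
    (hTindep : LinearIndependent ℂ T)
    (hTspan : ∀ P : MvPolynomial (Fin 2) ℂ, P.totalDegree < n →
      (fun z : ℝ × ℝ => MvPolynomial.eval (fun j => ((![z.1, z.2] j : ℝ) : ℂ)) P) ∈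
        Submodule.span ℂ (Set.range T))
    (hint : ∀ i l, IntegrableOn (fun z => (u z : ℂ) * T i z * conj (T l z)) D)
    (hintx : ∀ i l, IntegrableOn (fun z => (u z : ℂ) * (z.1 : ℂ) * T i z * conj (T l z)) D)
    (hinty : ∀ i l, IntegrableOn (fun z => (u z : ℂ) * (z.2 : ℂ) * T i z * conj (T l z)) D)
    (B Ax Ay : Matrix (Fin N) (Fin N) ℂ)
    (hB : ∀ i l, B i l = ∫ z in D, (u z : ℂ) * T i z * conj (T l z))
    (hAx : ∀ i l, Ax i l = ∫ z in D, (u z : ℂ) * (z.1 : ℂ) * T i z * conj (T l z))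
    (hAy : ∀ i l, Ay i l = ∫ z in D, (u z : ℂ) * (z.2 : ℂ) * T i z * conj (T l z)) :
    B.PosDef ∧
    ((∃ z : Fin N → ℝ × ℝ, ∃ w : Fin N → ℂ,
        (∀ j, z j ∈ D) ∧ Function.Injective z ∧ (∀ j, w j ≠ 0) ∧
        (∀ i l, B i l = ∑ j, w j * T i (z j) * conj (T l (z j))) ∧
        (∀ i l, Ax i l = ∑ j, w j * ((z j).1 : ℂ) * T i (z j) * conj (T l (z j))) ∧
        (∀ i l, Ay i l = ∑ j, w j * ((z j).2 : ℂ) * T i (z j) * conj (T l (z j))))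
      ↔
      (∃ z : Fin N → ℝ × ℝ,
        (∀ j, z j ∈ D) ∧ Function.Injective z ∧
        (∀ j, (fun i => T i (z j)) ≠ (0 : Fin N → ℂ)) ∧
        (∀ j, (Ax * B⁻¹).mulVec (fun i => T i (z j)) = ((z j).1 : ℂ) • (fun i => T i (z j))) ∧
        (∀ j, (Ay * B⁻¹).mulVec (fun i => T i (z j)) = ((z j).2 : ℂ) • (fun i => T i (z j))))) ∧
    (∀ z : Fin N → ℝ × ℝ, ∀ w : Fin N → ℂ,
      (∀ j, z j ∈ D) → Function.Injective z → (∀ j, w j ≠ 0) →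
      (∀ i l, B i l = ∑ j, w j * T i (z j) * conj (T l (z j))) →
      (∀ i l, Ax i l = ∑ j, w j * ((z j).1 : ℂ) * T i (z j) * conj (T l (z j))) →
      (∀ i l, Ay i l = ∑ j, w j * ((z j).2 : ℂ) * T i (z j) * conj (T l (z j))) →
      ∀ j, ∃ wr : ℝ, 0 < wr ∧ w j = (wr : ℂ)) := by
  have hPD : B.PosDef := aux_posDef n N D hDpos u hupos T hTpoly hTindep hint B hB
  have hQ : ∀ (z : Fin N → ℝ × ℝ) (w : Fin N → ℂ) (M : Matrix (Fin N) (Fin N) ℂ),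
      (∀ i l, M i l = ∑ j, w j * T i (z j) * conj (T l (z j))) ↔
      M = (Matrix.of fun i j => T i (z j)) * diagonal w * (Matrix.of fun i j => T i (z j))ᴴ := by
    intro z w M
    rw [← Matrix.ext_iff]
    simp only [aux_expand, Matrix.of_apply]
  refine ⟨hPD, ⟨?_, ?_⟩, ?_⟩
  · rintro ⟨z, w, hzD, hz, hw, h1, h2, h3⟩
    have h1' := (hQ z w B).mp h1
    have h2' := (hQ z (fun j => w j * ((z j).1 : ℂ)) Ax).mp h2
    have h3' := (hQ z (fun j => w j * ((z j).2 : ℂ)) Ay).mp h3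
    refine ⟨z, hzD, hz, ?_, fun j => aux_fwd _ B Ax w (fun j => ((z j).1 : ℂ)) hPD h1' h2' j,
      fun j => aux_fwd _ B Ay w (fun j => ((z j).2 : ℂ)) hPD h1' h3' j⟩
    intro j h0
    have hV := (Matrix.isUnit_iff_isUnit_det _).mp (aux_isUnit _ B w hPD h1')
    exact hV.ne_zero (Matrix.det_eq_zero_of_column_eq_zero j fun i => congrFun h0 i)
  · rintro ⟨z, hzD, hz, hv, hx, hy⟩
    obtain ⟨w, hw, h1, h2, h3⟩ := aux_bwd (Matrix.of fun i j => T i (z j)) B Ax Ay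
      (fun j => (z j).1) (fun j => (z j).2) hPD
      (aux_herm D u (fun z => z.1) T Ax hAx) (aux_herm D u (fun z => z.2) T Ay hAy)
      (fun j k h1 h2 => hz (Prod.ext h1 h2)) hv (aux_col _ _ _ hx) (aux_col _ _ _ hy)
    exact ⟨z, w, hzD, hz, hw, (hQ z w B).mpr h1,
      (hQ z (fun j => w j * ((z j).1 : ℂ)) Ax).mpr h2,
      (hQ z (fun j => w j * ((z j).2 : ℂ)) Ay).mpr h3⟩
  · intro z w _ _ _ h1 _ _ j
    have := aux_weights _ B w hPD ((hQ z w B).mp h1) j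
    obtain ⟨h1, h2⟩ := Complex.pos_iff.mp this
    exact ⟨(w j).re, h1, Complex.ext (by simp) (by simp [← h2])⟩
end

section
/- Let D ⊆ ℝ² be measurable, u : ℝ² → ℂ integrable on D, N := n(n+1)/2, and T_1, …, T_N : ℝ² → ℂ a basis of the complex bivariate polynomials of total degree < n; let B, A_x, A_y be the N×N Gramians B_{il} = ∫_D u T_i conj(T_l), (A_x)_{il} = ∫_D u(x,y) x T_i conj(T_l), (A_y)_{il} = ∫_D u(x,y) y T_i conj(T_l). Suppose there is an (N + r)-term quadrature: pairwise distinct points z_j = (x_j,y_j) ∈ D and nonzero complex weights w_j (j = 1, …, N + r) integrating B, A_x and A_y exactly. For the first r nodes define the deflated Gramians Ḃ := B − Σ_{j=1}^r w_j v_j v_j^H, Ȧ_x := A_x − Σ_{j=1}^r w_j x_j v_j v_j^H, Ȧ_y := A_y − Σ_{j=1}^r w_j y_j v_j v_j^H, where v_j := (T_1(z_j), …, T_N(z_j)) regarded as a column vector and v_j^H is its conjugate transpose. If Ḃ is invertible, then for every j with r + 1 ≤ j ≤ N + r one has (Ȧ_x Ḃ⁻¹) v_j = x_j v_j and (Ȧ_y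 Ḃ⁻¹) v_j = y_j v_j; in particular the remaining node coordinates x_j (resp. y_j), j = r+1, …, N+r, are eigenvalues of Ȧ_x Ḃ⁻¹ (resp. Ȧ_y Ḃ⁻¹). -/
open MeasureTheory ComplexConjugate Matrix

theorem aux_split (N r : ℕ) (f : Fin (N + r) → ℂ) :
    ∑ j, f j - ∑ j : Fin r, f (Fin.castLE (Nat.le_add_left r N) j)
      = ∑ k : Fin N, f (Fin.cast (Nat.add_comm r N) (Fin.natAdd r k)) := by
  have h : ∑ j, f j = ∑ j : Fin (r + N), f (Fin.cast (Nat.add_comm r N) j) :=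
    (Equiv.sum_comp (finCongr (Nat.add_comm r N)) f).symm
  rw [h, Fin.sum_univ_add]
  exact add_sub_cancel_left _ _

theorem aux_mat {N : ℕ} (V M A Bd : Matrix (Fin N) (Fin N) ℂ) (x : Fin N → ℂ)
    (hB : Bd = V * M) (hA : A = V * (Matrix.diagonal x * M)) (hu : IsUnit Bd.det) (k : Fin N) :
    (A * Bd⁻¹).mulVec (fun i => V i k) = x k • (fun i => V i k) := by
  have h1 : V * (M * Bd⁻¹) = 1 := by
    rw [← Matrix.mul_assoc, ← hB, Matrix.mul_nonsing_inv _ hu]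
  have h2 : M * Bd⁻¹ * V = 1 := mul_eq_one_comm.mp h1
  have h3 : A * Bd⁻¹ * V = V * Matrix.diagonal x := by
    calc A * Bd⁻¹ * V = V * Matrix.diagonal x * (M * Bd⁻¹ * V) := by
          rw [hA]; simp only [Matrix.mul_assoc]
      _ = _ := by rw [h2, Matrix.mul_one]
  funext i
  have h4 := congrFun (congrFun h3 i) k
  rw [Matrix.mul_diagonal, Matrix.mul_apply] at h4
  simp only [Matrix.mulVec, dotProduct, Pi.smul_apply, smul_eq_mul]
  rw [h4, mul_comm]

/-- Theorem 3b (deflation): if an `(N+r)`-term quadrature with pairwise distinct nodes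
`z_j ∈ D` and nonzero weights integrates the three Gramians `B`, `A_x`, `A_y` exactly,
and the Gramians deflated by the rank-one contributions of the first `r` nodes have `Ḃ`
invertible, then each remaining node vector `v_j = (T_1(z_j), …, T_N(z_j))`,
`r + 1 ≤ j ≤ N + r`, is an eigenvector of `Ȧ_x Ḃ⁻¹` (resp. `Ȧ_y Ḃ⁻¹`) with eigenvalue
`x_j` (resp. `y_j`). -/
theorem stmt_14 (n : ℕ) (hn : 1 ≤ n) (r : ℕ) (N : ℕ) (hN : N = n * (n + 1) / 2)
    (D : Set (ℝ × ℝ)) (hD : MeasurableSet D)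
    (u : ℝ × ℝ → ℂ) (hu : IntegrableOn u D)
    (T : Fin N → ℝ × ℝ → ℂ)
    (hTpoly : ∀ i, ∃ P : MvPolynomial (Fin 2) ℂ, P.totalDegree < n ∧
      ∀ z : ℝ × ℝ, T i z = MvPolynomial.eval (fun j => ((![z.1, z.2] j : ℝ) : ℂ)) P)
    (hTindep : LinearIndependent ℂ T)
    (hTspan : ∀ P : MvPolynomial (Fin 2) ℂ, P.totalDegree < n →
      (fun z : ℝ × ℝ => MvPolynomial.eval (fun j => ((![z.1, z.2] j : ℝ) : ℂ)) P) ∈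
        Submodule.span ℂ (Set.range T))
    (hint : ∀ i l, IntegrableOn (fun z => u z * T i z * conj (T l z)) D)
    (hintx : ∀ i l, IntegrableOn (fun z => u z * (z.1 : ℂ) * T i z * conj (T l z)) D)
    (hinty : ∀ i l, IntegrableOn (fun z => u z * (z.2 : ℂ) * T i z * conj (T l z)) D)
    (B Ax Ay : Matrix (Fin N) (Fin N) ℂ)
    (hB : ∀ i l, B i l = ∫ z in D, u z * T i z * conj (T l z))
    (hAx : ∀ i l, Ax i l = ∫ z in D, u z * (z.1 : ℂ) * T i z * conj (T l z))
    (hAy : ∀ i l, Ay i l = ∫ z in D, u z * (z.2 : ℂ) * T i z * conj (T l z))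
    (z : Fin (N + r) → ℝ × ℝ) (hzmem : ∀ j, z j ∈ D) (hzdist : Function.Injective z)
    (w : Fin (N + r) → ℂ) (hw : ∀ j, w j ≠ 0)
    (hqB : ∀ i l, B i l = ∑ j, w j * T i (z j) * conj (T l (z j)))
    (hqAx : ∀ i l, Ax i l = ∑ j, w j * ((z j).1 : ℂ) * T i (z j) * conj (T l (z j)))
    (hqAy : ∀ i l, Ay i l = ∑ j, w j * ((z j).2 : ℂ) * T i (z j) * conj (T l (z j)))
    (Bd Axd Ayd : Matrix (Fin N) (Fin N) ℂ)
    (hBd : Bd = B - ∑ j : Fin r, Matrix.of (fun i l =>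
      w (Fin.castLE (Nat.le_add_left r N) j) *
        T i (z (Fin.castLE (Nat.le_add_left r N) j)) *
        conj (T l (z (Fin.castLE (Nat.le_add_left r N) j)))))
    (hAxd : Axd = Ax - ∑ j : Fin r, Matrix.of (fun i l =>
      w (Fin.castLE (Nat.le_add_left r N) j) *
        ((z (Fin.castLE (Nat.le_add_left r N) j)).1 : ℂ) *
        T i (z (Fin.castLE (Nat.le_add_left r N) j)) *
        conj (T l (z (Fin.castLE (Nat.le_add_left r N) j)))))
    (hAyd : Ayd = Ay - ∑ j : Fin r, Matrix.of (fun i l =>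
      w (Fin.castLE (Nat.le_add_left r N) j) *
        ((z (Fin.castLE (Nat.le_add_left r N) j)).2 : ℂ) *
        T i (z (Fin.castLE (Nat.le_add_left r N) j)) *
        conj (T l (z (Fin.castLE (Nat.le_add_left r N) j)))))
    (hBdinv : IsUnit Bd.det) :
    ∀ j : Fin (N + r), r ≤ (j : ℕ) →
      (Axd * Bd⁻¹).mulVec (fun i => T i (z j)) = ((z j).1 : ℂ) • (fun i => T i (z j)) ∧
      (Ayd * Bd⁻¹).mulVec (fun i => T i (z j)) = ((z j).2 : ℂ) • (fun i => T i (z j)) := by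
  intro j hj
  obtain ⟨k, rfl⟩ : ∃ k : Fin N, Fin.cast (Nat.add_comm r N) (Fin.natAdd r k) = j :=
    ⟨⟨j - r, by omega⟩, by ext; simp; omega⟩
  set e : Fin N → Fin (N + r) := fun k => Fin.cast (Nat.add_comm r N) (Fin.natAdd r k) with he
  set V : Matrix (Fin N) (Fin N) ℂ := Matrix.of fun i k => T i (z (e k)) with hV
  set M : Matrix (Fin N) (Fin N) ℂ := Matrix.of fun k l => w (e k) * conj (T l (z (e k))) with hM
  have hBV : Bd = V * M := by
    ext i l
    rw [hBd, Matrix.sub_apply, Matrix.sum_apply, hqB, Matrix.mul_apply]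
    simp only [Matrix.of_apply]
    rw [aux_split N r (fun j => w j * T i (z j) * conj (T l (z j)))]
    refine Finset.sum_congr rfl fun k _ => ?_
    simp only [hV, hM, he, Matrix.of_apply]
    ring
  have hAV : Axd = V * (Matrix.diagonal (fun k => ((z (e k)).1 : ℂ)) * M) := by
    ext i l
    rw [hAxd, Matrix.sub_apply, Matrix.sum_apply, hqAx, Matrix.mul_apply]
    simp only [Matrix.of_apply]
    rw [aux_split N r (fun j => w j * ((z j).1 : ℂ) * T i (z j) * conj (T l (z j)))]
    refine Finset.sum_congr rfl fun k _ => ?_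
    simp only [hV, hM, he, Matrix.of_apply, Matrix.diagonal_mul]
    ring
  have hAV2 : Ayd = V * (Matrix.diagonal (fun k => ((z (e k)).2 : ℂ)) * M) := by
    ext i l
    rw [hAyd, Matrix.sub_apply, Matrix.sum_apply, hqAy, Matrix.mul_apply]
    simp only [Matrix.of_apply]
    rw [aux_split N r (fun j => w j * ((z j).2 : ℂ) * T i (z j) * conj (T l (z j)))]
    refine Finset.sum_congr rfl fun k _ => ?_
    simp only [hV, hM, he, Matrix.of_apply, Matrix.diagonal_mul]
    ring
  exact ⟨aux_mat V M Axd Bd _ hBV hAV hBdinv k, aux_mat V M Ayd Bd _ hBV hAV2 hBdinv k⟩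
end

section
/- Let u : [a,b] → ℂ be integrable and let T_1, …, T_n be a basis of the space of complex polynomial functions of degree < n. Suppose the n-term quadrature {x_j, w_j} (pairwise distinct nodes x_j ∈ [a,b], nonzero complex weights w_j) integrates both Gramians exactly: ∫_a^b u(x) T_i(x) conj(T_l(x)) dx = Σ_j w_j T_i(x_j) conj(T_l(x_j)) and ∫_a^b u(x) x T_i(x) conj(T_l(x)) dx = Σ_j w_j x_j T_i(x_j) conj(T_l(x_j)) for all 1 ≤ i, l ≤ n. Then the quadrature integrates all polynomials of degree less than 2n: for every complex polynomial P with deg P ≤ 2n − 1, ∫_a^b u(x) P(x) dx = Σ_{j=1}^n w_j P(x_j). -/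
open MeasureTheory ComplexConjugate Polynomial

theorem gram_aux {n : ℕ} (a b : ℝ) (v : ℝ → ℂ) (hv : IntervalIntegrable v volume a b)
    (T : Fin n → ℝ → ℂ) (hT : ∀ i, Continuous (T i)) (x : Fin n → ℝ) (w : Fin n → ℂ)
    (h : ∀ i l, (∫ t in a..b, v t * T i t * conj (T l t)) =
      ∑ j, w j * T i (x j) * conj (T l (x j)))
    (f g : ℝ → ℂ) (hf : f ∈ Submodule.span ℂ (Set.range T))
    (hg : g ∈ Submodule.span ℂ (Set.range T)) :
    (∫ t in a..b, v t * f t * conj (g t)) = ∑ j, w j * f (x j) * conj (g (x j)) := by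
  obtain ⟨c, rfl⟩ := (Submodule.mem_span_range_iff_exists_fun ℂ).1 hf
  obtain ⟨d, rfl⟩ := (Submodule.mem_span_range_iff_exists_fun ℂ).1 hg
  have key : ∀ (z : ℂ) (t : ℝ), z * (∑ i, c i • T i) t * conj ((∑ i, d i • T i) t) =
      ∑ i, ∑ l, (c i * conj (d l)) * (z * T i t * conj (T l t)) := by
    intro z t
    simp only [Finset.sum_apply, Pi.smul_apply, smul_eq_mul, map_sum, map_mul]
    rw [mul_assoc, Finset.sum_mul_sum, Finset.mul_sum]
    refine Finset.sum_congr rfl fun i _ => ?_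
    rw [Finset.mul_sum]
    refine Finset.sum_congr rfl fun l _ => ?_
    ring
  have hint : ∀ i l, IntervalIntegrable
      (fun t => (c i * conj (d l)) * (v t * T i t * conj (T l t))) volume a b := by
    intro i l
    apply IntervalIntegrable.const_mul
    apply IntervalIntegrable.mul_continuousOn
    · exact hv.mul_continuousOn (hT i).continuousOn
    · exact (Complex.continuous_conj.comp (hT l)).continuousOn
  simp only [key]
  rw [intervalIntegral.integral_finsetSum]
  · rw [Finset.sum_comm]
    refine Finset.sum_congr rfl fun i _ => ?_
    rw [intervalIntegral.integral_finsetSum (fun l _ => hint i l), Finset.sum_comm]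
    refine Finset.sum_congr rfl fun l _ => ?_
    rw [intervalIntegral.integral_const_mul, h, Finset.mul_sum]
  · intro i _
    have := IntervalIntegrable.sum (μ := volume) (a := a) (b := b) Finset.univ
      (f := fun l t => (c i * conj (d l)) * (v t * T i t * conj (T l t))) (fun l _ => hint i l)
    have e : (fun t => ∑ l, (c i * conj (d l)) * (v t * T i t * conj (T l t))) =
        ∑ l, fun t => (c i * conj (d l)) * (v t * T i t * conj (T l t)) := by
      ext t
      simp only [Finset.sum_apply]
    rw [e]
    exact this

/-- Claim at the end of Section 2.1: an `n`-term quadrature exact for both Gramians `A`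
(with multiplier `μ(x) = x`) and `B` of a basis `T_1, …, T_n` of the polynomials of degree
`< n` integrates every polynomial of degree `≤ 2n - 1` exactly against the weight `u`. -/
theorem stmt_15 (a b : ℝ) (hab : a < b) (n : ℕ) (hn : 1 ≤ n)
    (u : ℝ → ℂ) (hu : IntervalIntegrable u volume a b)
    (T : Fin n → ℝ → ℂ)
    (hTpoly : ∀ i, ∃ P : Polynomial ℂ, P.degree < (n : ℕ) ∧ ∀ t : ℝ, T i t = P.eval (t : ℂ))
    (hTindep : LinearIndependent ℂ T)
    (hTspan : ∀ P : Polynomial ℂ, P.degree < (n : ℕ) →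
      (fun t : ℝ => P.eval (t : ℂ)) ∈ Submodule.span ℂ (Set.range T))
    (x : Fin n → ℝ) (hxmem : ∀ j, x j ∈ Set.Icc a b) (hxdist : Function.Injective x)
    (w : Fin n → ℂ) (hw : ∀ j, w j ≠ 0)
    (hqB : ∀ i l, (∫ t in a..b, u t * T i t * conj (T l t)) =
      ∑ j, w j * T i (x j) * conj (T l (x j)))
    (hqA : ∀ i l, (∫ t in a..b, u t * (t : ℂ) * T i t * conj (T l t)) =
      ∑ j, w j * (x j : ℂ) * T i (x j) * conj (T l (x j))) :
    ∀ P : Polynomial ℂ, P.degree < ((2 * n : ℕ) : ℕ) →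
      (∫ t in a..b, u t * P.eval (t : ℂ)) = ∑ j, w j * P.eval ((x j : ℂ)) := by
  have hT : ∀ i, Continuous (T i) := by
    intro i
    obtain ⟨P, -, hP⟩ := hTpoly i
    have : T i = fun t : ℝ => P.eval (t : ℂ) := funext hP
    rw [this]
    exact P.continuous.comp Complex.continuous_ofReal
  have hpow : ∀ k, k < n → (fun t : ℝ => (t : ℂ) ^ k) ∈ Submodule.span ℂ (Set.range T) := by
    intro k hk
    have := hTspan (X ^ k) (by rw [degree_X_pow]; exact_mod_cast hk)
    simpa using this
  have hmon : ∀ k, k < 2 * n →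
      (∫ t in a..b, u t * (t : ℂ) ^ k) = ∑ j, w j * (x j : ℂ) ^ k := by
    intro k hk
    by_cases hkn : k < n
    · have := gram_aux a b u hu T hT x w hqB _ _ (hpow k hkn) (hpow 0 (by omega))
      simpa using this
    · have hv : IntervalIntegrable (fun t => u t * (t : ℂ)) volume a b :=
        hu.mul_continuousOn Complex.continuous_ofReal.continuousOn
      have := gram_aux a b _ hv T hT x (fun j => w j * (x j : ℂ)) hqA _ _
        (hpow (k - n) (by omega)) (hpow (n - 1) (by omega))
      have e : ∀ z y : ℂ, z * y * y ^ (k - n) * y ^ (n - 1) = z * y ^ k := by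
        intro z y
        have : k = 1 + (k - n) + (n - 1) := by omega
        conv_rhs => rw [this, pow_add, pow_add, pow_one]
        ring
      simpa only [map_pow, Complex.conj_ofReal, e] using this
  intro P hP
  have hPe : ∀ z y : ℂ, z * P.eval y = ∑ k ∈ Finset.range (2 * n), P.coeff k * (z * y ^ k) := by
    intro z y
    have hd : P.natDegree < 2 * n := by
      by_cases h0 : P = 0
      · subst h0; simp; omega
      · exact (natDegree_lt_iff_degree_lt h0).2 hP
    rw [eval_eq_sum_range' hd, Finset.mul_sum]
    exact Finset.sum_congr rfl fun k _ => by ring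
  simp only [hPe]
  rw [intervalIntegral.integral_finsetSum, Finset.sum_comm]
  · refine Finset.sum_congr rfl fun k hk => ?_
    rw [intervalIntegral.integral_const_mul, hmon k (Finset.mem_range.1 hk), Finset.mul_sum]
  · intro k _
    apply IntervalIntegrable.const_mul
    exact hu.mul_continuousOn (Complex.continuous_ofReal.pow k).continuousOn
end
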